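/- Suppose Assumptions A1 and A2 hold, (1−q)/2 ≤ p < 1 − q, 4q + s + p − 2 < 0, and 3q + s − p − 1 < 0, and set r = max{q, p−q−s}. Let (x,λ) be a global solution of the dynamical system, let (x_t,λ_t) be the unique saddle point of L_t with t ↦ (x_t,λ_t) continuously differentiable, and let (x*,λ*) be the projection of the origin onto Ω. Then, as t → +∞: L(x(t),λ*) − L(x*,λ*) = O(√(m(t)) t^{(3q+s+p−2+r)/2} + t^{−p}), |f(x(t)) − f(x*)| = O(√(m(t)) t^{(3q+s+p−2+r)/2} + t^{−p}), ‖Ax(t) − b‖ = O(√(m(t)) t^{(3q+s+p−2+r)/2} + t^{−p}), and ‖(x(t)−x_t, λ(t)−λ_t)‖² = O(m(t) t^{3q+s+p−2+r}). -/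

import Mathlib

open Real Filter Asymptotics
open scoped RealInnerProductSpace Topology

/-- The gradient inequality for differentiable convex functions. -/
theorem ConvexOn.add_inner_gradient_le {X : Type*} [NormedAddCommGroup X] [InnerProductSpace ℝ X]
    [CompleteSpace X] {f : X → ℝ} {f' : X → X} (hf : ∀ u, HasGradientAt f (f' u) u)
    (hconv : ConvexOn ℝ Set.univ f) (u v : X) : f u + ⟪f' u, v - u⟫ ≤ f v := by
  have hline : HasDerivAt (fun τ : ℝ => f (AffineMap.lineMap u v τ)) ⟪f' u, v - u⟫ 0 := by
    have h1 : HasFDerivAt f (InnerProductSpace.toDual ℝ X (f' u))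
        (AffineMap.lineMap u v (0 : ℝ)) := by
      simpa using (hf u).hasFDerivAt
    have h2 : HasDerivAt (AffineMap.lineMap u v : ℝ → X) (v - u) 0 :=
      AffineMap.hasDerivAt_lineMap
    simpa [Function.comp_def] using h1.comp_hasDerivAt (0 : ℝ) h2
  have hc : ConvexOn ℝ Set.univ (fun τ : ℝ => f (AffineMap.lineMap u v τ)) := by
    simpa [Function.comp_def] using hconv.comp_affineMap (AffineMap.lineMap u v : ℝ →ᵃ[ℝ] X)
  have := hc.le_slope_of_hasDerivAt (Set.mem_univ 0) (Set.mem_univ 1) one_pos hline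
  rw [slope_def_field] at this
  simp at this
  simp only [inner_sub_right] at this ⊢
  linarith

theorem ConvexOn.inner_gradient_sub_nonneg {X : Type*} [NormedAddCommGroup X]
    [InnerProductSpace ℝ X] [CompleteSpace X] {f : X → ℝ} {f' : X → X}
    (hf : ∀ u, HasGradientAt f (f' u) u) (hconv : ConvexOn ℝ Set.univ f) (u v : X) :
    0 ≤ ⟪f' u - f' v, u - v⟫ := by
  have h1 := hconv.add_inner_gradient_le hf u v
  have h2 := hconv.add_inner_gradient_le hf v u
  simp only [inner_sub_left, inner_sub_right] at *
  linarith

/-- Comparison principle for `E' ≤ -K ρ E + C ρ W` when the weight `W` decays slowly. -/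
theorem exists_le_const_mul_of_deriv_le {E E' W W' ρ : ℝ → ℝ} {K C T : ℝ} (hK : 0 < K)
    (hρ : ∀ t ≥ T, 0 < ρ t) (hW : ∀ t ≥ T, 0 < W t)
    (hE' : ∀ t ≥ T, HasDerivAt E (E' t) t) (hW' : ∀ t ≥ T, HasDerivAt W (W' t) t)
    (hE : ∀ t ≥ T, E' t ≤ -K * ρ t * E t + C * (ρ t * W t))
    (hslow : ∀ t ≥ T, -(K / 2) * (ρ t * W t) ≤ W' t) :
    ∃ D, 0 < D ∧ ∀ t ≥ T, E t ≤ D * W t := by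
  obtain ⟨D, hD0, hDC, hDT⟩ : ∃ D : ℝ, 0 < D ∧ 2 * C / K < D ∧ E T / W T ≤ D :=
    ⟨max (E T / W T) (max 1 (2 * C / K + 1)), by positivity,
      lt_of_lt_of_le (lt_add_one _) (le_trans (le_max_right _ _) (le_max_right _ _)),
      le_max_left _ _⟩
  refine ⟨D, hD0, fun t ht => ?_⟩
  refine image_le_of_deriv_right_lt_deriv_boundary' (a := T) (b := t) (f := E) (f' := E')
    (B := fun t => D * W t) (B' := fun t => D * W' t)
    (fun y hy => (hE' y hy.1).continuousAt.continuousWithinAt)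
    (fun y hy => (hE' y hy.1).hasDerivWithinAt) ((div_le_iff₀ (hW T le_rfl)).1 hDT)
    (fun y hy => ((hW' y hy.1).const_mul D).continuousAt.continuousWithinAt)
    (fun y hy => ((hW' y hy.1).const_mul D).hasDerivWithinAt) ?_ ⟨ht, le_rfl⟩
  intro y hy hEy
  have h1 := hE y hy.1
  have h2 := mul_le_mul_of_nonneg_left (hslow y hy.1) hD0.le
  have h3 : 0 < ρ y * W y := mul_pos (hρ y hy.1) (hW y hy.1)
  have h4 : 0 < (K * D / 2 - C) * (ρ y * W y) := by
    refine mul_pos ?_ h3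
    rw [div_lt_iff₀ hK] at hDC
    linarith
  rw [hEy] at h1
  nlinarith

section Saddle

variable {X Y : Type*} [NormedAddCommGroup X] [InnerProductSpace ℝ X] [CompleteSpace X]
  [NormedAddCommGroup Y] [InnerProductSpace ℝ Y] [CompleteSpace Y]

theorem apply_eq_of_forall_inner_le {E : Type*} [NormedAddCommGroup E] [InnerProductSpace ℝ E]
    {l d : E} (h : ∀ μ : E, ⟪μ, d⟫ ≤ ⟪l, d⟫) : d = 0 := by
  have := h (l + d)
  rw [inner_add_left] at this
  rw [real_inner_self_eq_norm_sq] at this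
  exact norm_eq_zero.1 (pow_eq_zero_iff two_ne_zero |>.1 (le_antisymm (by linarith) (sq_nonneg _)))

/-- Saddle points of the Tikhonov regularized Lagrangian are bounded by any saddle point. -/
theorem norm_sq_regularized_saddle_le {f : X → ℝ} {f' : X → X} (hf : ∀ u, HasGradientAt f (f' u) u)
    (hconv : ConvexOn ℝ Set.univ f) (A : X →L[ℝ] Y) {b : Y} {xs u : X} {ls l : Y} {ε : ℝ}
    (hε : 0 < ε) (hA : A xs = b) (hmin : ∀ u, f xs ≤ f u + ⟪ls, A u - b⟫)
    (hx : f' u + ContinuousLinearMap.adjoint A l + ε • u = 0) (hl : A u - b - ε • l = 0) :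
    ‖u‖ ^ 2 + ‖l‖ ^ 2 ≤ ‖xs‖ ^ 2 + ‖ls‖ ^ 2 := by
  have h1 := hmin u
  have h2 := hconv.add_inner_gradient_le hf u xs
  have hl' : A u - b = ε • l := sub_eq_zero.1 hl
  have hx' : f' u = -(ContinuousLinearMap.adjoint A l) - ε • u := by
    rw [eq_sub_iff_add_eq, eq_neg_iff_add_eq_zero, ← hx]; abel
  have h3 : A (xs - u) = -(ε • l) := by rw [map_sub, hA, ← hl']; abel
  rw [hl', inner_smul_right] at h1
  rw [hx', inner_sub_left, inner_neg_left, ContinuousLinearMap.adjoint_inner_left, h3,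
    inner_neg_right, inner_smul_right, inner_smul_left, inner_sub_right,
    real_inner_self_eq_norm_sq, real_inner_self_eq_norm_sq] at h2
  simp only [conj_trivial] at h2
  have h4 : ε * (‖l‖ ^ 2 + ‖u‖ ^ 2) ≤ ε * (⟪ls, l⟫ + ⟪u, xs⟫) := by linarith
  have h5 := le_of_mul_le_mul_left h4 hε
  have h6 := real_inner_le_norm ls l
  have h7 := real_inner_le_norm u xs
  nlinarith [sq_nonneg (‖ls‖ - ‖l‖), sq_nonneg (‖u‖ - ‖xs‖)]

/-- The velocity of a differentiable curve of regularized saddle points. -/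
theorem norm_sq_deriv_regularized_saddle_le {f : X → ℝ} {f' : X → X}
    (hf : ∀ u, HasGradientAt f (f' u) u) (hconv : ConvexOn ℝ Set.univ f) (A : X →L[ℝ] Y) {b : Y}
    {ε : ℝ → ℝ} {xt : ℝ → X} {lt : ℝ → Y} {t δ R : ℝ} {y : X} {η : Y}
    (hδ : 0 ≤ δ) (hε0 : 0 < ε t)
    (hsaddle : ∀ τ ≥ t, f' (xt τ) + ContinuousLinearMap.adjoint A (lt τ) + ε τ • xt τ = 0 ∧
      A (xt τ) - b - ε τ • lt τ = 0)
    (hε : HasDerivAt ε (-(δ * ε t)) t) (hx : HasDerivAt xt y t) (hl : HasDerivAt lt η t)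
    (hR : ‖xt t‖ ^ 2 + ‖lt t‖ ^ 2 ≤ R) :
    ‖y‖ ^ 2 + ‖η‖ ^ 2 ≤ δ ^ 2 * R := by
  have key : ∀ τ > t, ε t * (‖slope xt t τ‖ ^ 2 + ‖slope lt t τ‖ ^ 2)
      + slope ε t τ * (⟪xt τ, slope xt t τ⟫ + ⟪lt τ, slope lt t τ⟫) ≤ 0 := by
    intro τ hτ
    obtain ⟨h1, h2⟩ := hsaddle t le_rfl
    obtain ⟨h3, h4⟩ := hsaddle τ hτ.le
    have hm := hconv.inner_gradient_sub_nonneg hf (xt τ) (xt t)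
    have e1 : f' (xt τ) - f' (xt t) = -(ContinuousLinearMap.adjoint A (lt τ - lt t))
        - ε t • (xt τ - xt t) - (ε τ - ε t) • xt τ := by
      have h5 : f' (xt τ) = -(ContinuousLinearMap.adjoint A (lt τ)) - ε τ • xt τ := by
        rw [eq_sub_iff_add_eq, eq_neg_iff_add_eq_zero, ← h3]; abel
      have h6 : f' (xt t) = -(ContinuousLinearMap.adjoint A (lt t)) - ε t • xt t := by
        rw [eq_sub_iff_add_eq, eq_neg_iff_add_eq_zero, ← h1]; abel
      rw [h5, h6, map_sub]; module
    have e2 : A (xt τ - xt t) = ε t • (lt τ - lt t) + (ε τ - ε t) • lt τ := by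
      have h5 : A (xt τ) = b + ε τ • lt τ := by rw [sub_sub, sub_eq_zero] at h4; exact h4
      have h6 : A (xt t) = b + ε t • lt t := by rw [sub_sub, sub_eq_zero] at h2; exact h2
      rw [map_sub, h5, h6]; module
    rw [e1, inner_sub_left, inner_sub_left, inner_neg_left,
      ContinuousLinearMap.adjoint_inner_left, e2, inner_add_right, inner_smul_right,
      inner_smul_right, inner_smul_left, inner_smul_left, real_inner_self_eq_norm_sq,
      real_inner_self_eq_norm_sq, real_inner_comm] at hm
    simp only [conj_trivial] at hm
    simp only [slope, vsub_eq_sub, inner_smul_right, norm_smul, smul_eq_mul, mul_pow,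
      Real.norm_eq_abs, sq_abs]
    have h7 := mul_nonneg (sq_nonneg (τ - t)⁻¹) hm
    linarith
  have hx1 : Tendsto (slope xt t) (𝓝[>] t) (𝓝 y) :=
    (hasDerivAt_iff_tendsto_slope.1 hx).mono_left (nhdsWithin_mono _ fun z hz => ne_of_gt hz)
  have hl1 : Tendsto (slope lt t) (𝓝[>] t) (𝓝 η) :=
    (hasDerivAt_iff_tendsto_slope.1 hl).mono_left (nhdsWithin_mono _ fun z hz => ne_of_gt hz)
  have he1 : Tendsto (slope ε t) (𝓝[>] t) (𝓝 (-(δ * ε t))) :=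
    (hasDerivAt_iff_tendsto_slope.1 hε).mono_left (nhdsWithin_mono _ fun z hz => ne_of_gt hz)
  have hx2 : Tendsto xt (𝓝[>] t) (𝓝 (xt t)) := hx.continuousAt.mono_left nhdsWithin_le_nhds
  have hl2 : Tendsto lt (𝓝[>] t) (𝓝 (lt t)) := hl.continuousAt.mono_left nhdsWithin_le_nhds
  have hlim := ((((hx1.norm.pow 2).add (hl1.norm.pow 2)).const_mul (ε t)).add
    (he1.mul ((hx2.inner hx1).add (hl2.inner hl1))))
  have hle := le_of_tendsto hlim (eventually_nhdsWithin_of_forall key)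
  have h8 : ε t * (‖y‖ ^ 2 + ‖η‖ ^ 2) ≤ ε t * (δ * (⟪xt t, y⟫ + ⟪lt t, η⟫)) := by linarith
  have h9 := le_of_mul_le_mul_left h8 hε0
  have h10 := mul_le_mul_of_nonneg_left (real_inner_le_norm (xt t) y) hδ
  have h11 := mul_le_mul_of_nonneg_left (real_inner_le_norm (lt t) η) hδ
  nlinarith [sq_nonneg (δ * ‖xt t‖ - ‖y‖), sq_nonneg (δ * ‖lt t‖ - ‖η‖),
    mul_le_mul_of_nonneg_left hR (sq_nonneg δ)]

end Saddle

section Energy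

variable {X Y : Type*} [NormedAddCommGroup X] [InnerProductSpace ℝ X] [CompleteSpace X]
  [NormedAddCommGroup Y] [InnerProductSpace ℝ Y] [CompleteSpace Y]

/-- Strong convexity of the regularized Lagrangian around its saddle point. -/
theorem regularized_gap_lower {f : X → ℝ} {f' : X → X}
    (hf : ∀ u, HasGradientAt f (f' u) u) (hconv : ConvexOn ℝ Set.univ f) (A : X →L[ℝ] Y)
    {u z : X} {l : Y} {ε : ℝ} (hz : f' z + ContinuousLinearMap.adjoint A l + ε • z = 0) :
    ε / 2 * ‖u - z‖ ^ 2 ≤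
      f u - f z + ⟪l, A (u - z)⟫ + ε / 2 * (‖u‖ ^ 2 - ‖z‖ ^ 2) := by
  have h1 := hconv.add_inner_gradient_le hf z u
  have h2 : f' z = -(ContinuousLinearMap.adjoint A l) - ε • z := by
    rw [eq_sub_iff_add_eq, eq_neg_iff_add_eq_zero, ← hz]; abel
  rw [h2, inner_sub_left, inner_neg_left, ContinuousLinearMap.adjoint_inner_left,
    inner_smul_left, inner_sub_right, real_inner_self_eq_norm_sq, real_inner_comm u z] at h1
  simp only [conj_trivial] at h1
  rw [norm_sub_sq_real]
  linarith

theorem regularized_gap_add_le_inner {f : X → ℝ} {f' : X → X}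
    (hf : ∀ u, HasGradientAt f (f' u) u) (hconv : ConvexOn ℝ Set.univ f) (A : X →L[ℝ] Y)
    (u z : X) (l : Y) (ε : ℝ) :
    f u - f z + ⟪l, A (u - z)⟫ + ε / 2 * (‖u‖ ^ 2 - ‖z‖ ^ 2) + ε / 2 * ‖u - z‖ ^ 2 ≤
      ⟪f' u + ContinuousLinearMap.adjoint A l + ε • u, u - z⟫ := by
  have h1 := hconv.add_inner_gradient_le hf u z
  rw [← neg_sub u z, inner_neg_right] at h1
  rw [inner_add_left, inner_add_left, ContinuousLinearMap.adjoint_inner_left,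
    inner_smul_left, norm_sub_sq_real, inner_sub_right u, real_inner_self_eq_norm_sq]
  simp only [conj_trivial]
  linarith

theorem energy_deriv_eq (A : X →L[ℝ] Y) {w v g y h : X} {μ η : Y}
    {a n n1 β σ θ ε G : ℝ} (hh : g = h + ContinuousLinearMap.adjoint A μ)
    (ha : a = σ * β * θ) (ha' : a = n * β + G * (1 - n1)) :
    a * (⟪h, v⟫ + ⟪η, A w⟫)
      + ⟪σ • w + n • v + G • g, -(1 - n1) • v - β • g - σ • y⟫
      + ⟪μ, (σ * β) • (A w + θ • A v - ε • μ) - η⟫ + σ * (1 - n1) * ⟪w, v - y⟫ =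
    a * ⟪η, A w⟫ - σ * β * ⟪h, w⟫ - n * (1 - n1) * ‖v‖ ^ 2 - G * β * ‖g‖ ^ 2
      - σ * β * ε * ‖μ‖ ^ 2 - ⟪μ, η⟫ - σ * ⟪σ • w + n • v + G • g, y⟫
      - σ * (1 - n1) * ⟪w, y⟫ := by
  have e1 : ⟪h, v⟫ = ⟪g, v⟫ - ⟪μ, A v⟫ := by
    rw [hh, inner_add_left, ContinuousLinearMap.adjoint_inner_left]; ring
  have e2 : ⟪h, w⟫ = ⟪g, w⟫ - ⟪μ, A w⟫ := by
    rw [hh, inner_add_left, ContinuousLinearMap.adjoint_inner_left]; ring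
  rw [e1, e2]
  simp only [inner_add_left, inner_sub_right, inner_add_right, inner_smul_left,
    inner_smul_right, real_inner_self_eq_norm_sq, conj_trivial, real_inner_comm v w,
    real_inner_comm g w, real_inner_comm g v]
  linear_combination (⟪g, v⟫) * ha' - ⟪μ, A v⟫ * ha

theorem energy_deriv_le {f : X → ℝ} {f' : X → X}
    (hf : ∀ u, HasGradientAt f (f' u) u) (hconv : ConvexOn ℝ Set.univ f) (A : X →L[ℝ] Y)
    {u z v g y : X} {l lz η : Y} {a a1 n n1 n2 β σ θ ε δ G Φ Φ' e R : ℝ}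
    (hg : g = f' u + ContinuousLinearMap.adjoint A l + ε • u)
    (hz : f' z + ContinuousLinearMap.adjoint A lz + ε • z = 0)
    (ha : a = σ * β * θ) (ha' : a = n * β + G * (1 - n1))
    (hΦ : Φ = f u - f z + ⟪lz, A (u - z)⟫ + ε / 2 * (‖u‖ ^ 2 - ‖z‖ ^ 2))
    (hΦ' : Φ' = ⟪f' u, v⟫ - ⟪f' z, y⟫ + (⟪lz, A (v - y)⟫ + ⟪η, A (u - z)⟫)
      + (-(δ * ε) / 2 * (‖u‖ ^ 2 - ‖z‖ ^ 2) + ε / 2 * (2 * ⟪u, v⟫ - 2 * ⟪z, y⟫)))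
    (ha0 : 0 ≤ a) (hβ : 0 ≤ β) (hσ : 0 ≤ σ) (hn : 0 ≤ n) (hG : 0 ≤ G) (hε : 0 ≤ ε) (hδ : 0 ≤ δ)
    (hn1 : |n1| ≤ 1 / 2) (hy : ‖y‖ ≤ e) (hη : ‖η‖ ≤ e) (hR : ‖z‖ ≤ R) :
    a1 * Φ + a * Φ' + ⟪σ • (u - z) + n • v + G • g, -(1 - n1) • v - β • g - σ • y⟫
      + ⟪l - lz, (σ * β) • (A (u - z) + θ • A v - ε • (l - lz)) - η⟫
      + (σ * (1 - n1) * ⟪u - z, v - y⟫ - σ / 2 * n2 * ‖u - z‖ ^ 2) ≤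
    (a1 - σ * β) * Φ - σ * β * (ε / 2) * ‖u - z‖ ^ 2 - σ * β * ε * ‖l - lz‖ ^ 2
      - n / 2 * ‖v‖ ^ 2 - G * β * ‖g‖ ^ 2
      + a * (‖A‖ * e + ε * δ * R) * ‖u - z‖ + e * ‖l - lz‖
      + σ * e * (σ * ‖u - z‖ + n * ‖v‖ + G * ‖g‖) + 2 * σ * e * ‖u - z‖
      + σ / 2 * |n2| * ‖u - z‖ ^ 2 := by
  set h := f' u + ContinuousLinearMap.adjoint A lz + ε • u with hh
  have hgh : g = h + ContinuousLinearMap.adjoint A (l - lz) := by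
    rw [hg, hh, map_sub]; abel
  have hid := energy_deriv_eq A (w := u - z) (v := v) (y := y) (μ := l - lz) (η := η) (ε := ε)
    hgh ha ha'
  have hΦ'' : Φ' = ⟪h, v⟫ + ⟪η, A (u - z)⟫ - δ * ε / 2 * (‖u‖ ^ 2 - ‖z‖ ^ 2) := by
    have h2 : f' z = -(ContinuousLinearMap.adjoint A lz) - ε • z := by
      rw [eq_sub_iff_add_eq, eq_neg_iff_add_eq_zero, ← hz]; abel
    rw [hΦ', h2, hh]
    simp only [inner_add_left, inner_sub_left, inner_neg_left, inner_smul_left, conj_trivial,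
      ContinuousLinearMap.adjoint_inner_left, map_sub, inner_sub_right]
    ring
  have hlow := mul_le_mul_of_nonneg_left (regularized_gap_add_le_inner hf hconv A u z lz ε)
    (mul_nonneg hσ hβ)
  rw [← hΦ, ← hh] at hlow
  have he : 0 ≤ e := (norm_nonneg y).trans hy
  obtain ⟨hn1l, hn1u⟩ := abs_le.1 hn1
  have b1 : ⟪η, A (u - z)⟫ ≤ ‖A‖ * e * ‖u - z‖ := by
    calc ⟪η, A (u - z)⟫ ≤ ‖η‖ * ‖A (u - z)‖ := real_inner_le_norm _ _
      _ ≤ e * (‖A‖ * ‖u - z‖) := by gcongr; exact A.le_opNorm _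
      _ = _ := by ring
  have b2 : -(‖u‖ ^ 2 - ‖z‖ ^ 2) ≤ 2 * R * ‖u - z‖ := by
    have h3 : ‖z‖ - ‖u‖ ≤ ‖u - z‖ := by rw [norm_sub_rev]; exact norm_sub_norm_le z u
    rcases le_total ‖z‖ ‖u‖ with h4 | h4
    · have : 0 ≤ R * ‖u - z‖ := mul_nonneg ((norm_nonneg z).trans hR) (norm_nonneg _)
      nlinarith [norm_nonneg z]
    · calc -(‖u‖ ^ 2 - ‖z‖ ^ 2) = (‖z‖ - ‖u‖) * (‖z‖ + ‖u‖) := by ring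
        _ ≤ ‖u - z‖ * (R + R) := by
            apply mul_le_mul h3 (add_le_add hR (h4.trans hR)) (by positivity) (norm_nonneg _)
        _ = 2 * R * ‖u - z‖ := by ring
  have b3 : -⟪l - lz, η⟫ ≤ e * ‖l - lz‖ := by
    calc -⟪l - lz, η⟫ ≤ ‖l - lz‖ * ‖η‖ := (neg_le_abs _).trans (abs_real_inner_le_norm _ _)
      _ ≤ ‖l - lz‖ * e := by gcongr
      _ = _ := by ring
  have b4 : -⟪σ • (u - z) + n • v + G • g, y⟫ ≤ e * (σ * ‖u - z‖ + n * ‖v‖ + G * ‖g‖) := by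
    calc -⟪σ • (u - z) + n • v + G • g, y⟫ ≤ ‖σ • (u - z) + n • v + G • g‖ * ‖y‖ :=
          (neg_le_abs _).trans (abs_real_inner_le_norm _ _)
      _ ≤ (‖σ • (u - z)‖ + ‖n • v‖ + ‖G • g‖) * e := by
          gcongr; exact norm_add₃_le
      _ = _ := by
          rw [norm_smul, norm_smul, norm_smul, Real.norm_of_nonneg hσ, Real.norm_of_nonneg hn,
            Real.norm_of_nonneg hG]; ring
  have b5 : (1 - n1) * -⟪u - z, y⟫ ≤ 2 * (e * ‖u - z‖) := by
    have h5 : -⟪u - z, y⟫ ≤ e * ‖u - z‖ := by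
      calc -⟪u - z, y⟫ ≤ ‖u - z‖ * ‖y‖ := (neg_le_abs _).trans (abs_real_inner_le_norm _ _)
        _ ≤ ‖u - z‖ * e := by gcongr
        _ = _ := by ring
    have h6 : 0 ≤ e * ‖u - z‖ := by positivity
    calc (1 - n1) * -⟪u - z, y⟫ ≤ (1 - n1) * (e * ‖u - z‖) := by
          apply mul_le_mul_of_nonneg_left h5; linarith
      _ ≤ 2 * (e * ‖u - z‖) := by apply mul_le_mul_of_nonneg_right _ h6; linarith
  have b6 : -(σ / 2 * n2 * ‖u - z‖ ^ 2) ≤ σ / 2 * |n2| * ‖u - z‖ ^ 2 := by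
    have : σ / 2 * -n2 * ‖u - z‖ ^ 2 ≤ σ / 2 * |n2| * ‖u - z‖ ^ 2 := by
      gcongr; exact neg_le_abs n2
    linarith
  have b7 : n / 2 * ‖v‖ ^ 2 ≤ n * (1 - n1) * ‖v‖ ^ 2 := by
    have : n * (1 / 2) * ‖v‖ ^ 2 ≤ n * (1 - n1) * ‖v‖ ^ 2 := by gcongr; linarith
    linarith
  have c1 := mul_le_mul_of_nonneg_left b1 ha0
  have c2 := mul_le_mul_of_nonneg_left b2 (mul_nonneg ha0 (mul_nonneg hδ hε))
  have c4 := mul_le_mul_of_nonneg_left b4 hσ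
  have c5 := mul_le_mul_of_nonneg_left b5 hσ
  rw [hΦ'']
  linarith

end Energy

section Scalar

theorem mul_mul_le_young {κ P D e W : ℝ} (hκ : 0 < κ) (hP : 0 < P) :
    D * e * W ≤ κ * (P * W ^ 2) + D ^ 2 / (4 * κ) * (e ^ 2 / P) := by
  have h : 0 ≤ (2 * κ * P * W - D * e) ^ 2 / (4 * κ * P) := by positivity
  have h2 : (2 * κ * P * W - D * e) ^ 2 / (4 * κ * P) =
      κ * (P * W ^ 2) + D ^ 2 / (4 * κ) * (e ^ 2 / P) - D * e * W := by
    field_simp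
    ring
  linarith

/-- Pointwise domination of the perturbation terms by the dissipation, up to a source term. -/
theorem dissipation_le {σ c γ p M D R : ℝ} (hσ : 0 < σ) (hc : 0 < c) (hγ : 0 < γ)
    (hp : 0 ≤ p) (hM : 0 ≤ M) (hD : 0 ≤ D) (hR : 0 ≤ R) :
    ∃ κ > 0, ∃ C > 0, ∀ t tq ts tp n n1 β a a1 n2 Φ W U V G : ℝ,
      1 ≤ t → 1 ≤ tq → 1 ≤ ts → 1 ≤ tp → γ ≤ n * ts → |n1| ≤ 1 / 2 →
      tq * ts / 2 ≤ β → β ≤ tq * ts → a = n * β + γ * tq * (1 - n1) → a1 ≤ σ / 4 * (tq * ts) →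
      |n2| ≤ c / 8 * (tq * ts / tp) → 0 ≤ Φ → 0 ≤ W → 0 ≤ U → 0 ≤ V → 0 ≤ G →
      (a1 - σ * β) * Φ - σ * β * (c / tp / 2) * W ^ 2 - σ * β * (c / tp) * U ^ 2
        - n / 2 * V ^ 2 - γ * tq * β * G ^ 2
        + a * (D * (M / t) + c / tp * (p / t) * R) * W + M / t * U
        + σ * (M / t) * (σ * W + n * V + γ * tq * G) + 2 * σ * (M / t) * W
        + σ / 2 * |n2| * W ^ 2 ≤
      -κ * (tq * ts * Φ + tq * ts / tp * W ^ 2 + tq * ts / tp * U ^ 2 + n * V ^ 2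
        + tq * (tq * ts) * G ^ 2) + C * (n ^ 2 * (tq * ts) * tp / t ^ 2) := by
  set κ := min (min (σ / 4) (σ * c / 8)) (min (1 / 4) (γ / 4)) with hκ
  have hκ0 : 0 < κ := by rw [hκ]; positivity
  have k1 : κ ≤ σ / 4 := (min_le_left _ _).trans (min_le_left _ _)
  have k2 : κ ≤ σ * c / 8 := (min_le_left _ _).trans (min_le_right _ _)
  have k3 : κ ≤ 1 / 4 := (min_le_right _ _).trans (min_le_left _ _)
  have k4 : κ ≤ γ / 4 := (min_le_right _ _).trans (min_le_right _ _)
  set D1 := 3 * (D * M + c * p * R) + (σ ^ 2 + 2 * σ) * (M / γ) with hD1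
  set C := D1 ^ 2 / (4 * (σ * c / 16)) + (M / γ) ^ 2 / (4 * (σ * c / 4))
    + (σ * M) ^ 2 / (4 * (1 / 4)) / γ + (σ * M * γ) ^ 2 / (4 * (γ / 4)) / γ ^ 2 + 1 with hC
  refine ⟨κ, hκ0, C, by positivity, ?_⟩
  intro t tq ts tp n n1 β a a1 n2 Φ W U V G ht htq hts htp hn hn1 hβl hβu ha ha1 hn2 hΦ hW hU hV hG
  have t0 : 0 < t := by linarith
  have tq0 : 0 < tq := by linarith
  have ts0 : 0 < ts := by linarith
  have tp0 : 0 < tp := by linarith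
  have n0 : 0 < n := pos_of_mul_pos_left (hγ.trans_le hn) ts0.le
  obtain ⟨hn1l, hn1u⟩ := abs_le.1 hn1
  set B := tq * ts with hB
  have hB0 : 0 < B := by positivity
  set P := B / tp with hP
  have hP0 : 0 < P := by positivity
  have hβ0 : 0 < β := by linarith
  set N := n ^ 2 * B * tp / t ^ 2 with hN
  set E := n * B / t with hE
  have hEN : E ^ 2 / P = N := by rw [hE, hP, hN]; field_simp
  have hnB : γ * tq ≤ n * B := by
    calc γ * tq ≤ n * ts * tq := by gcongr
      _ = n * B := by rw [hB]; ring
  have hnB1 : γ ≤ n * B := (le_mul_of_one_le_right hγ.le htq).trans hnB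
  have hau : a ≤ 3 * (n * B) := by
    have h1 : n * β ≤ n * B := by gcongr
    have h2 : γ * tq * (1 - n1) ≤ γ * tq * 2 := by gcongr; linarith
    rw [ha]; linarith
  have hMt : M / t ≤ M / γ * E := by
    have : M / γ * γ / t ≤ M / γ * (n * B) / t := by gcongr
    rw [div_mul_cancel₀ _ hγ.ne'] at this
    rw [hE]; linarith [mul_div_assoc (M / γ) (n * B) t]
  have hE0 : 0 < E := by positivity
  have hN0 : 0 < N := by positivity
  have r1 : (a1 - σ * β) * Φ ≤ -κ * (B * Φ) := by
    have : (a1 - σ * β) * Φ ≤ (-κ * B) * Φ := by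
      have h1 := mul_le_mul_of_nonneg_left hβl hσ.le
      have h2 := mul_le_mul_of_nonneg_right k1 hB0.le
      gcongr
      linarith
    linarith
  have r2 : c / 2 * P ≤ β * (c / tp) := by
    calc c / 2 * P = B / 2 * (c / tp) := by rw [hP]; ring
      _ ≤ β * (c / tp) := by gcongr
  have r3 : a * (D * (M / t) + c / tp * (p / t) * R) * W ≤ 3 * (D * M + c * p * R) * E * W := by
    have h1 : D * (M / t) + c / tp * (p / t) * R ≤ (D * M + c * p * R) / t := by
      have : c / tp * (p / t) * R ≤ c * (p / t) * R := by
        gcongr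
        exact div_le_self hc.le htp
      calc _ ≤ D * (M / t) + c * (p / t) * R := by gcongr
        _ = _ := by ring
    calc a * (D * (M / t) + c / tp * (p / t) * R) * W
        ≤ 3 * (n * B) * ((D * M + c * p * R) / t) * W := by gcongr
      _ = 3 * (D * M + c * p * R) * E * W := by rw [hE]; ring
  have r4 : (σ ^ 2 + 2 * σ) * (M / t) * W ≤ (σ ^ 2 + 2 * σ) * (M / γ) * E * W := by
    rw [mul_assoc _ (M / γ) E]; gcongr
  have y1 := mul_mul_le_young (D := D1) (e := E) (W := W)
    (show 0 < σ * c / 16 by positivity) hP0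
  have r5 : M / t * U ≤ M / γ * E * U := by gcongr
  have y2 := mul_mul_le_young (D := M / γ) (e := E) (W := U)
    (show 0 < σ * c / 4 by positivity) hP0
  have y3 := mul_mul_le_young (D := σ * M) (e := n / t) (W := V)
    (show (0 : ℝ) < 1 / 4 by positivity) n0
  have y4 := mul_mul_le_young (D := σ * M * γ) (e := tq / t) (W := G)
    (show (0 : ℝ) < γ / 4 by positivity) (show 0 < tq * B by positivity)
  have r6 : (n / t) ^ 2 / n ≤ N / γ := by
    rw [le_div_iff₀ hγ]
    have h1 : γ ≤ n * B * tp := hnB1.trans (le_mul_of_one_le_right (by positivity) htp)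
    calc (n / t) ^ 2 / n * γ ≤ (n / t) ^ 2 / n * (n * B * tp) := by gcongr
      _ = N := by rw [hN]; field_simp
  have r7 : (tq / t) ^ 2 / (tq * B) ≤ N / γ ^ 2 := by
    rw [le_div_iff₀ (by positivity)]
    have h1 : γ ^ 2 ≤ (n * ts) ^ 2 * (tq * tp) := by
      have h2 : γ ^ 2 ≤ (n * ts) ^ 2 := by gcongr
      exact h2.trans (le_mul_of_one_le_right (by positivity)
        (one_le_mul_of_one_le_of_one_le htq htp))
    calc (tq / t) ^ 2 / (tq * B) * γ ^ 2
        ≤ (tq / t) ^ 2 / (tq * B) * ((n * ts) ^ 2 * (tq * tp)) := by gcongr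
      _ = N := by rw [hN, hB]; field_simp
  have r6' := mul_le_mul_of_nonneg_left r6
    (show 0 ≤ (σ * M) ^ 2 / (4 * (1 / 4)) by positivity)
  have r7' := mul_le_mul_of_nonneg_left r7
    (show 0 ≤ (σ * M * γ) ^ 2 / (4 * (γ / 4)) by positivity)
  have r8 : σ / 2 * |n2| * W ^ 2 ≤ σ * c / 16 * (P * W ^ 2) := by
    calc σ / 2 * |n2| * W ^ 2 ≤ σ / 2 * (c / 8 * P) * W ^ 2 := by gcongr
      _ = _ := by ring
  have r9 : σ * c / 4 * (P * W ^ 2) ≤ σ * β * (c / tp / 2) * W ^ 2 := by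
    calc σ * c / 4 * (P * W ^ 2) = σ / 2 * (c / 2 * P) * W ^ 2 := by ring
      _ ≤ σ / 2 * (β * (c / tp)) * W ^ 2 := by gcongr
      _ = _ := by ring
  have r10 : σ * c / 2 * (P * U ^ 2) ≤ σ * β * (c / tp) * U ^ 2 := by
    calc σ * c / 2 * (P * U ^ 2) = σ * (c / 2 * P) * U ^ 2 := by ring
      _ ≤ σ * (β * (c / tp)) * U ^ 2 := by gcongr
      _ = _ := by ring
  have r11 : γ / 2 * (tq * B * G ^ 2) ≤ γ * tq * β * G ^ 2 := by
    calc γ / 2 * (tq * B * G ^ 2) = γ * tq * (B / 2) * G ^ 2 := by ring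
      _ ≤ γ * tq * β * G ^ 2 := by gcongr
  have q2 := mul_le_mul_of_nonneg_right k2 (show 0 ≤ P * W ^ 2 by positivity)
  have q2' := mul_le_mul_of_nonneg_right k2 (show 0 ≤ P * U ^ 2 by positivity)
  have q3 := mul_le_mul_of_nonneg_right k3 (show 0 ≤ n * V ^ 2 by positivity)
  have q4 := mul_le_mul_of_nonneg_right k4 (show 0 ≤ tq * B * G ^ 2 by positivity)
  have q5 : 0 ≤ σ * c / 8 * (P * U ^ 2) := by positivity
  rw [hEN] at y1 y2
  have hCN : C * N = D1 ^ 2 / (4 * (σ * c / 16)) * N + (M / γ) ^ 2 / (4 * (σ * c / 4)) * N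
    + (σ * M) ^ 2 / (4 * (1 / 4)) * (N / γ)
    + (σ * M * γ) ^ 2 / (4 * (γ / 4)) * (N / γ ^ 2) + N := by
    rw [hC]; ring
  rw [hCN]
  have z3 : σ * M * (n / t) * V = σ * (M / t) * (n * V) := by ring
  have z4 : σ * M * γ * (tq / t) * G = σ * (M / t) * (γ * tq * G) := by ring
  have z1 : D1 * E * W = 3 * (D * M + c * p * R) * E * W
    + (σ ^ 2 + 2 * σ) * (M / γ) * E * W := by rw [hD1]; ring
  rw [z3] at y3
  rw [z4] at y4
  rw [z1] at y1
  clear_value C D1 κ N E P B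
  linarith

theorem energy_le_dissipation {σ γ k : ℝ} (hσ : 0 < σ) (hγ : 0 < γ) (hk : 0 < k) :
    ∃ K > 0, ∀ tq ts tp tr n n1 β a Φ W U V G Z : ℝ,
      1 ≤ tq → 1 ≤ ts → 1 ≤ tp → 1 ≤ tr → tp ≤ tr * (tq * ts) → γ ≤ n * ts → n ≤ k →
      |n1| ≤ 1 / 2 →
      0 ≤ β → β ≤ tq * ts → a = n * β + γ * tq * (1 - n1) → 0 ≤ Φ → 0 ≤ W → 0 ≤ V → 0 ≤ G →
      0 ≤ Z → Z ≤ σ * W + n * V + γ * tq * G →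
      a * Φ + (Z ^ 2 + U ^ 2) / 2 + σ / 2 * (1 - n1) * W ^ 2 ≤
      K * (tr * (tq * ts * Φ + tq * ts / tp * W ^ 2 + tq * ts / tp * U ^ 2 + n * V ^ 2
        + tq * (tq * ts) * G ^ 2)) := by
  set K := 3 * k + (3 * σ ^ 2 + σ) + 1 + 3 * k + 3 * γ ^ 2 with hK
  refine ⟨K, by positivity, ?_⟩
  intro tq ts tp tr n n1 β a Φ W U V G Z htq hts htp htr htptr hn hnk hn1 hβ hβu
    ha hΦ hW hV hG hZ hZu
  have tq0 : 0 < tq := by linarith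
  have ts0 : 0 < ts := by linarith
  have tp0 : 0 < tp := by linarith
  have tr0 : 0 < tr := by linarith
  have n0 : 0 < n := pos_of_mul_pos_left (hγ.trans_le hn) ts0.le
  obtain ⟨hn1l, hn1u⟩ := abs_le.1 hn1
  set B := tq * ts with hB
  have hB0 : 0 < B := by positivity
  have hnB : γ * tq ≤ n * B := by
    calc γ * tq ≤ n * ts * tq := by gcongr
      _ = n * B := by rw [hB]; ring
  have hau : a ≤ 3 * k * B := by
    have h1 : n * β ≤ n * B := by gcongr
    have h2 : γ * tq * (1 - n1) ≤ γ * tq * 2 := by gcongr; linarith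
    have h3 : n * B ≤ k * B := by gcongr
    rw [ha]; linarith
  have h1 : 1 ≤ tr * (B / tp) := by
    rw [← mul_div_assoc, le_div_iff₀ tp0]; linarith
  have a1 : a * Φ ≤ 3 * k * (tr * (B * Φ)) := by
    calc a * Φ ≤ 3 * k * B * Φ := by gcongr
      _ = 3 * k * (1 * (B * Φ)) := by ring
      _ ≤ _ := by gcongr
  have a2 : W ^ 2 ≤ tr * (B / tp * W ^ 2) := by
    rw [← mul_assoc]; exact le_mul_of_one_le_left (sq_nonneg _) h1
  have a3 : U ^ 2 ≤ tr * (B / tp * U ^ 2) := by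
    rw [← mul_assoc]; exact le_mul_of_one_le_left (sq_nonneg _) h1
  have a4 : (n * V) ^ 2 ≤ k * (tr * (n * V ^ 2)) := by
    calc (n * V) ^ 2 = n * (1 * (n * V ^ 2)) := by ring
      _ ≤ k * (tr * (n * V ^ 2)) := by gcongr
  have a5 : (γ * tq * G) ^ 2 ≤ γ ^ 2 * (tr * (tq * B * G ^ 2)) := by
    calc (γ * tq * G) ^ 2 = γ ^ 2 * (1 * (tq * (tq * 1) * G ^ 2)) := by ring
      _ ≤ γ ^ 2 * (tr * (tq * (tq * ts) * G ^ 2)) := by gcongr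
  have a6 : Z ^ 2 ≤ 3 * (σ ^ 2 * W ^ 2 + (n * V) ^ 2 + (γ * tq * G) ^ 2) := by
    calc Z ^ 2 ≤ (σ * W + n * V + γ * tq * G) ^ 2 := by gcongr
      _ ≤ _ := by nlinarith [sq_nonneg (σ * W - n * V), sq_nonneg (σ * W - γ * tq * G),
                    sq_nonneg (n * V - γ * tq * G)]
  have a7 : σ / 2 * (1 - n1) * W ^ 2 ≤ σ / 2 * 2 * W ^ 2 := by
    gcongr; linarith
  have a8 := mul_le_mul_of_nonneg_left a2 (show 0 ≤ 3 * σ ^ 2 + σ by positivity)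
  have p1 : 0 ≤ tr * (B * Φ) := by positivity
  have p2 : 0 ≤ tr * (B / tp * W ^ 2) := by positivity
  have p3 : 0 ≤ tr * (B / tp * U ^ 2) := by positivity
  have p4 : 0 ≤ tr * (n * V ^ 2) := by positivity
  have p5 : 0 ≤ tr * (tq * B * G ^ 2) := by positivity
  have s1 := sq_nonneg σ
  have s2 := sq_nonneg γ
  have c1 : 3 * k ≤ K := by rw [hK]; linarith
  have c2 : 3 * σ ^ 2 + σ ≤ K := by rw [hK]; linarith
  have c3 : 1 ≤ K := by rw [hK]; linarith
  have c5 : 3 * γ ^ 2 ≤ K := by rw [hK]; linarith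
  have d1 := mul_le_mul_of_nonneg_right c1 p1
  have d2 := mul_le_mul_of_nonneg_right c2 p2
  have d3 := mul_le_mul_of_nonneg_right c3 p3
  have d4 := mul_le_mul_of_nonneg_right c1 p4
  have d5 := mul_le_mul_of_nonneg_right c5 p5
  have hW2 : 0 ≤ σ ^ 2 * W ^ 2 := by positivity
  have hW3 : 0 ≤ σ * W ^ 2 := by positivity
  have g1 : 0 ≤ k * (tr * (n * V ^ 2)) := by positivity
  have g2 : 0 ≤ γ ^ 2 * (tr * (tq * B * G ^ 2)) := by positivity
  have g3 := sq_nonneg U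
  clear_value K B
  linarith

end Scalar

section Coefficients

/-- Size of the coefficients of the energy function and of their derivatives, written in terms of
`tq = t ^ q`, `ts = t ^ s` and `tp = t ^ p`. -/
theorem coefficient_bounds {q s γ k₁ k₂ σ c : ℝ} (hq : 0 < q) (hq1 : q < 1) (hs : 0 < s)
    (hγ : 0 < γ) (hk₁ : 0 < k₁) (hk₂ : 0 < k₂) (hσ : 0 < σ) (hc : 0 < c) :
    ∃ T : ℝ, ∀ t tq ts tp m m1 m2 : ℝ, T ≤ t → 1 ≤ t → 1 ≤ tq → 1 ≤ ts → 1 ≤ tp → tp ≤ t →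
      0 < m → m ≤ k₁ / tq → t * |m1| ≤ k₂ * m → t ^ 2 * |m2| ≤ k₂ * m →
      ∀ n n1 n2 β β1 : ℝ, n = m * tq → n1 = m1 * tq + m * (q * (tq / t)) →
      n2 = m2 * tq + 2 * (m1 * (q * (tq / t))) + m * (q * ((q - 1) * (tq / t ^ 2))) →
      β = tq * ts - γ * q * (tq / t) →
      β1 = (q + s) * (tq * ts / t) - γ * q * ((q - 1) * (tq / t ^ 2)) →
      n ≤ k₁ ∧ |n1| ≤ (k₂ + q) * (n / t) ∧ |n1| ≤ 1 / 2 ∧ tq * ts / 2 ≤ β ∧ β ≤ tq * ts ∧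
      n1 * β + n * β1 + (γ * (q * (tq / t)) * (1 - n1) - γ * tq * n2) ≤ σ / 4 * (tq * ts) ∧
      |n2| ≤ c / 8 * (tq * ts / tp) := by
  set C2 := (k₂ + 2 * q * k₂ + q) * k₁ with hC2
  set C3 := (k₂ + q) * k₁ + k₁ * (q + s + γ * q) + 2 * γ * q + γ * C2 with hC3
  refine ⟨max (max (2 * ((k₂ + q) * k₁)) (2 * (γ * q))) (max (4 * C3 / σ) (8 * C2 / c)), ?_⟩
  intro t tq ts tp m m1 m2 hT ht htq hts htp htpt hm hmk hm1 hm2 n n1 n2 β β1 hn hn1 hn2 hβ hβ1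
  have hTa : 2 * ((k₂ + q) * k₁) ≤ t := ((le_max_left _ _).trans (le_max_left _ _)).trans hT
  have hTb : 2 * (γ * q) ≤ t := ((le_max_right _ _).trans (le_max_left _ _)).trans hT
  have hTc : 4 * C3 / σ ≤ t := ((le_max_left _ _).trans (le_max_right _ _)).trans hT
  have hTd : 8 * C2 / c ≤ t := ((le_max_right _ _).trans (le_max_right _ _)).trans hT
  have t0 : 0 < t := by linarith
  have tq0 : 0 < tq := by linarith
  have ts0 : 0 < ts := by linarith
  have tp0 : 0 < tp := by linarith
  have hn0 : 0 < n := by rw [hn]; positivity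
  have hnk : n ≤ k₁ := by rw [hn]; exact (le_div_iff₀ tq0).1 hmk
  have hB0 : 0 < tq * ts := by positivity
  have hm1' : |m1| * tq ≤ k₂ * n / t := by
    rw [le_div_iff₀ t0, hn]
    calc |m1| * tq * t = t * |m1| * tq := by ring
      _ ≤ k₂ * m * tq := by gcongr
      _ = _ := by ring
  have hm2' : |m2| * tq ≤ k₂ * n / t ^ 2 := by
    rw [le_div_iff₀ (by positivity), hn]
    calc |m2| * tq * t ^ 2 = t ^ 2 * |m2| * tq := by ring
      _ ≤ k₂ * m * tq := by gcongr
      _ = _ := by ring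
  have bn1 : |n1| ≤ (k₂ + q) * (n / t) := by
    calc |n1| ≤ |m1 * tq| + |m * (q * (tq / t))| := by rw [hn1]; exact abs_add_le _ _
      _ = |m1| * tq + m * (q * (tq / t)) := by
          rw [abs_mul, abs_of_pos tq0, abs_of_pos (show 0 < m * (q * (tq / t)) by positivity)]
      _ ≤ k₂ * n / t + m * (q * (tq / t)) := by gcongr
      _ = _ := by rw [hn]; ring
  have bn1t : |n1| ≤ (k₂ + q) * k₁ / t := by
    calc |n1| ≤ (k₂ + q) * (n / t) := bn1
      _ ≤ (k₂ + q) * (k₁ / t) := by gcongr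
      _ = _ := by ring
  have bn1h : |n1| ≤ 1 / 2 := by
    refine bn1t.trans ?_
    rw [div_le_iff₀ t0]; linarith
  have bn2 : |n2| ≤ C2 / t ^ 2 := by
    have hq' : |q - 1| ≤ 1 := by rw [abs_le]; constructor <;> linarith
    calc |n2| ≤ |m2 * tq| + |2 * (m1 * (q * (tq / t)))| + |m * (q * ((q - 1) * (tq / t ^ 2)))| := by
          rw [hn2]; exact abs_add_three _ _ _
      _ = |m2| * tq + 2 * (q / t * (|m1| * tq)) + m * (q * (|q - 1| * (tq / t ^ 2))) := by
          rw [abs_mul, abs_of_pos tq0, abs_mul, abs_mul m1, abs_mul m,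
            abs_mul q ((q - 1) * (tq / t ^ 2)), abs_mul (q - 1),
            abs_of_pos hm, abs_of_pos hq, abs_of_pos (show 0 < q * (tq / t) by positivity),
            abs_of_pos (show 0 < tq / t ^ 2 by positivity), abs_of_pos (show (0 : ℝ) < 2 by simp)]
          ring
      _ ≤ k₂ * n / t ^ 2 + 2 * (q / t * (k₂ * n / t)) + m * (q * (1 * (tq / t ^ 2))) := by gcongr
      _ = (k₂ + 2 * q * k₂ + q) * n / t ^ 2 := by rw [hn]; field_simp
      _ ≤ C2 / t ^ 2 := by rw [hC2]; gcongr
  have hC20 : 0 < C2 := by rw [hC2]; positivity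
  have htt : 1 / t ^ 2 ≤ 1 / t := by
    apply one_div_le_one_div_of_le t0; nlinarith
  have bβl : tq * ts / 2 ≤ β := by
    have : γ * q * (tq / t) ≤ tq * ts / 2 := by
      calc γ * q * (tq / t) = γ * q / t * tq := by ring
        _ ≤ 1 / 2 * tq := by
            refine mul_le_mul_of_nonneg_right ?_ tq0.le
            rw [div_le_iff₀ t0]; linarith
        _ ≤ 1 / 2 * (tq * ts) := by gcongr; exact le_mul_of_one_le_right tq0.le hts
        _ = _ := by ring
    rw [hβ]; linarith
  have bβu : β ≤ tq * ts := by
    have : 0 ≤ γ * q * (tq / t) := by positivity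
    rw [hβ]; linarith
  have htqB : tq ≤ tq * ts := le_mul_of_one_le_right tq0.le hts
  have bβ1 : β1 ≤ (q + s + γ * q) * (tq * ts / t) := by
    have : -(γ * q * ((q - 1) * (tq / t ^ 2))) ≤ γ * q * (tq * ts / t) := by
      calc -(γ * q * ((q - 1) * (tq / t ^ 2))) = γ * q * ((1 - q) * (tq * (1 / t ^ 2))) := by ring
        _ ≤ γ * q * (1 * (tq * ts * (1 / t))) := by gcongr; linarith
        _ = _ := by ring
    rw [hβ1]; linarith
  have x1 : n1 * β ≤ (k₂ + q) * k₁ * (tq * ts / t) := by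
    have hβ0 : 0 ≤ β := by linarith
    calc n1 * β ≤ (k₂ + q) * k₁ / t * (tq * ts) := by
          gcongr
          exact (le_abs_self _).trans bn1t
      _ = _ := by ring
  have x2 : n * β1 ≤ k₁ * (q + s + γ * q) * (tq * ts / t) := by
    calc n * β1 ≤ n * ((q + s + γ * q) * (tq * ts / t)) := by gcongr
      _ ≤ k₁ * ((q + s + γ * q) * (tq * ts / t)) := by gcongr
      _ = _ := by ring
  have x3 : γ * (q * (tq / t)) * (1 - n1) ≤ 2 * γ * q * (tq * ts / t) := by
    calc γ * (q * (tq / t)) * (1 - n1) ≤ γ * (q * (tq * ts / t)) * 2 := by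
          have h1 := abs_le.1 bn1h
          have h2 : 0 ≤ 1 - n1 := by linarith
          gcongr
          linarith
      _ = _ := by ring
  have x4 : -(γ * tq * n2) ≤ γ * C2 * (tq * ts / t) := by
    calc -(γ * tq * n2) = γ * tq * -n2 := by ring
      _ ≤ γ * (tq * ts) * (C2 / t ^ 2) := by
          refine (mul_le_mul_of_nonneg_left ((neg_le_abs _).trans bn2) (by positivity)).trans ?_
          gcongr
      _ = γ * (tq * ts) * (C2 * (1 / t ^ 2)) := by ring
      _ ≤ γ * (tq * ts) * (C2 * (1 / t)) := by gcongr
      _ = _ := by ring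
  refine ⟨hnk, bn1, bn1h, bβl, bβu, ?_, ?_⟩
  · have h1 : C3 * (tq * ts / t) ≤ σ / 4 * (tq * ts) := by
      calc C3 * (tq * ts / t) = C3 / t * (tq * ts) := by ring
        _ ≤ σ / 4 * (tq * ts) := by
            refine mul_le_mul_of_nonneg_right ?_ hB0.le
            rw [div_le_iff₀ hσ] at hTc
            rw [div_le_iff₀ t0]; linarith
    have h2 : C3 * (tq * ts / t) = (k₂ + q) * k₁ * (tq * ts / t)
      + k₁ * (q + s + γ * q) * (tq * ts / t) + 2 * γ * q * (tq * ts / t)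
      + γ * C2 * (tq * ts / t) := by rw [hC3]; ring
    linarith
  · calc |n2| ≤ C2 / t * (1 / t) := by
          refine bn2.trans (le_of_eq ?_)
          rw [sq]; field_simp
      _ ≤ c / 8 * (1 / tp) := by
          have : C2 / t ≤ c / 8 := by
            rw [div_le_iff₀ hc] at hTd
            rw [div_le_iff₀ t0]; linarith
          gcongr
      _ ≤ c / 8 * (tq * ts / tp) := by gcongr; linarith

end Coefficients

section Gap

theorem norm_residual_le {X Y : Type*} [NormedAddCommGroup X] [InnerProductSpace ℝ X]
    [NormedAddCommGroup Y] [InnerProductSpace ℝ Y] (A : X →L[ℝ] Y) {b : Y} {u z : X} {l : Y}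
    {ε R : ℝ} (hε : 0 ≤ ε) (hl : A z - b - ε • l = 0) (hlR : ‖l‖ ≤ R) :
    ‖A u - b‖ ≤ ‖A‖ * ‖u - z‖ + ε * R := by
  have h1 : A u - b = A (u - z) + ε • l := by
    rw [← sub_eq_zero.1 hl, map_sub]; abel
  calc ‖A u - b‖ ≤ ‖A (u - z)‖ + ‖ε • l‖ := by rw [h1]; exact norm_add_le _ _
    _ ≤ ‖A‖ * ‖u - z‖ + ε * R := by
        rw [norm_smul, Real.norm_of_nonneg hε]
        gcongr
        exact A.le_opNorm _

variable {X Y : Type*} [NormedAddCommGroup X] [InnerProductSpace ℝ X] [CompleteSpace X]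
  [NormedAddCommGroup Y] [InnerProductSpace ℝ Y] [CompleteSpace Y]

theorem abs_objective_gap_le {f : X → ℝ} {f' : X → X} (hf : ∀ u, HasGradientAt f (f' u) u)
    (hconv : ConvexOn ℝ Set.univ f) (A : X →L[ℝ] Y) {b : Y} {xs u z : X} {ls l : Y} {ε R : ℝ}
    (hε : 0 ≤ ε) (hA : A xs = b) (hmin : ∀ u, f xs ≤ f u + ⟪ls, A u - b⟫)
    (hz : f' z + ContinuousLinearMap.adjoint A l + ε • z = 0) (hl : A z - b - ε • l = 0)
    (hzR : ‖z‖ ≤ R) (hlR : ‖l‖ ≤ R) (hxsR : ‖xs‖ ≤ R) (hlsR : ‖ls‖ ≤ R) :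
    |f u - f xs| ≤ (f u - f z + ⟪l, A (u - z)⟫ + ε / 2 * (‖u‖ ^ 2 - ‖z‖ ^ 2))
      + R * ‖A‖ * ‖u - z‖ + ε / 2 * (‖u - z‖ ^ 2 + 2 * R * ‖u - z‖) + ε * R ^ 2 := by
  have hR : 0 ≤ R := (norm_nonneg z).trans hzR
  have hl' : A z - b = ε • l := sub_eq_zero.1 hl
  have h1 := hmin z
  have h2 := hconv.add_inner_gradient_le hf z xs
  have hz' : f' z = -(ContinuousLinearMap.adjoint A l) - ε • z := by
    rw [eq_sub_iff_add_eq, eq_neg_iff_add_eq_zero, ← hz]; abel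
  have h3 : A (xs - z) = -(ε • l) := by rw [map_sub, hA, ← hl']; abel
  rw [hl', inner_smul_right] at h1
  rw [hz', inner_sub_left, inner_neg_left, ContinuousLinearMap.adjoint_inner_left, h3,
    inner_neg_right, inner_smul_right, inner_smul_left, inner_sub_right,
    real_inner_self_eq_norm_sq, real_inner_self_eq_norm_sq] at h2
  simp only [conj_trivial] at h2
  have h4 : ⟪ls, l⟫ ≤ R ^ 2 := by
    rw [sq]; exact (real_inner_le_norm _ _).trans (by gcongr)
  have h5 : ⟪z, xs⟫ ≤ R ^ 2 := by
    rw [sq]; exact (real_inner_le_norm _ _).trans (by gcongr)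
  have h6 : |⟪l, A (u - z)⟫| ≤ R * ‖A‖ * ‖u - z‖ := by
    rw [mul_assoc]
    refine (abs_real_inner_le_norm _ _).trans ?_
    gcongr
    exact A.le_opNorm _
  have h7 : |⟪z, u - z⟫| ≤ R * ‖u - z‖ := by
    refine (abs_real_inner_le_norm _ _).trans ?_
    gcongr
  have h8 : ‖u‖ ^ 2 - ‖z‖ ^ 2 = ‖u - z‖ ^ 2 + 2 * ⟪z, u - z⟫ := by
    rw [inner_sub_right, real_inner_self_eq_norm_sq, norm_sub_sq_real, real_inner_comm z u]; ring
  have h9 := (regularized_gap_lower hf hconv A (u := u) hz).trans' (by positivity)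
  have h4' := mul_le_mul_of_nonneg_left h4 hε
  have h5' := mul_le_mul_of_nonneg_left h5 hε
  have h10 : 0 ≤ ε * ‖l‖ ^ 2 := by positivity
  have h11 : 0 ≤ ε * ‖z‖ ^ 2 := by positivity
  have h12 : 0 ≤ ε * ‖u - z‖ ^ 2 := by positivity
  have h7' := mul_le_mul_of_nonneg_left (abs_le.1 h7).1 hε
  have h7'' := mul_le_mul_of_nonneg_left (abs_le.1 h7).2 hε
  rw [h8] at h9 ⊢
  obtain ⟨h6l, h6u⟩ := abs_le.1 h6
  rw [abs_le]
  constructor <;> linarith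

end Gap

section EnergyDerivative

variable {X Y : Type*} [NormedAddCommGroup X] [InnerProductSpace ℝ X] [CompleteSpace X]
  [NormedAddCommGroup Y] [InnerProductSpace ℝ Y]

theorem hasDerivAt_energy {f : X → ℝ} {f' : X → X} (hf : ∀ u, HasGradientAt f (f' u) u)
    (A : X →L[ℝ] Y) {x x' g z : ℝ → X} {l lz : ℝ → Y} {ε a n n1 G : ℝ → ℝ}
    {x'' gd y : X} {l' η : Y} {β σ δ a1 n2 G' t : ℝ}
    (hx : HasDerivAt x (x' t) t) (hx' : HasDerivAt x' x'' t) (hg : HasDerivAt g gd t)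
    (hz : HasDerivAt z y t) (hl : HasDerivAt l l' t) (hlz : HasDerivAt lz η t)
    (hε : HasDerivAt ε (-(δ * ε t)) t) (ha : HasDerivAt a a1 t) (hn : HasDerivAt n (n1 t) t)
    (hn1 : HasDerivAt n1 n2 t) (hG : HasDerivAt G G' t)
    (hode : n t • x'' + (σ + 1) • x' t + G t • gd + (β + G') • g t = 0) :
    HasDerivAt (fun τ => a τ * (f (x τ) - f (z τ) + ⟪lz τ, A (x τ - z τ)⟫
        + ε τ / 2 * (‖x τ‖ ^ 2 - ‖z τ‖ ^ 2))
      + (‖σ • (x τ - z τ) + n τ • x' τ + G τ • g τ‖ ^ 2 + ‖l τ - lz τ‖ ^ 2) / 2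
      + σ / 2 * (1 - n1 τ) * ‖x τ - z τ‖ ^ 2)
      (a1 * (f (x t) - f (z t) + ⟪lz t, A (x t - z t)⟫ + ε t / 2 * (‖x t‖ ^ 2 - ‖z t‖ ^ 2))
      + a t * (⟪f' (x t), x' t⟫ - ⟪f' (z t), y⟫ + (⟪lz t, A (x' t - y)⟫ + ⟪η, A (x t - z t)⟫)
        + (-(δ * ε t) / 2 * (‖x t‖ ^ 2 - ‖z t‖ ^ 2) + ε t / 2 * (2 * ⟪x t, x' t⟫ - 2 * ⟪z t, y⟫)))
      + ⟪σ • (x t - z t) + n t • x' t + G t • g t, -(1 - n1 t) • x' t - β • g t - σ • y⟫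
      + ⟪l t - lz t, l' - η⟫
      + (σ * (1 - n1 t) * ⟪x t - z t, x' t - y⟫ - σ / 2 * n2 * ‖x t - z t‖ ^ 2)) t := by
  have hw := hx.sub hz
  have hfx : HasDerivAt (fun τ => f (x τ)) ⟪f' (x t), x' t⟫ t := by
    simpa [Function.comp_def] using (hf (x t)).hasFDerivAt.comp_hasDerivAt t hx
  have hfz : HasDerivAt (fun τ => f (z τ)) ⟪f' (z t), y⟫ t := by
    simpa [Function.comp_def] using (hf (z t)).hasFDerivAt.comp_hasDerivAt t hz
  have hAw : HasDerivAt (fun τ => A (x τ - z τ)) (A (x' t - y)) t := by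
    simpa [Function.comp_def] using A.hasFDerivAt.comp_hasDerivAt t hw
  have hΦ := ((hfx.sub hfz).add (hlz.inner ℝ hAw)).add
    ((hε.div_const 2).mul (hx.norm_sq.sub hz.norm_sq))
  have hu : HasDerivAt (fun τ => σ • (x τ - z τ) + n τ • x' τ + G τ • g τ)
      (-(1 - n1 t) • x' t - β • g t - σ • y) t := by
    refine (((hw.const_smul σ).add (hn.smul hx')).add (hG.smul hg)).congr_deriv ?_
    have h1 : n t • x'' = -((σ + 1) • x' t + G t • gd + (β + G') • g t) := by
      rw [eq_neg_iff_add_eq_zero, ← hode]; abel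
    rw [h1]; module
  have hE := ((ha.mul hΦ).add ((hu.norm_sq.add (hl.sub hlz).norm_sq).div_const 2)).add
    (((hn1.const_sub 1).const_mul (σ / 2)).mul hw.norm_sq)
  refine hE.congr_deriv ?_
  simp only [Pi.add_apply, Pi.sub_apply, Pi.mul_apply]
  ring

end EnergyDerivative

section Rates

variable {X Y : Type*} [NormedAddCommGroup X] [InnerProductSpace ℝ X] [CompleteSpace X]
  [NormedAddCommGroup Y] [InnerProductSpace ℝ Y] [CompleteSpace Y]

theorem rpow_mul_le_eventually {r C : ℝ} (hr : r < 1) :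
    ∀ᶠ t : ℝ in atTop, C * t ^ r ≤ t := by
  filter_upwards [(tendsto_rpow_atTop (show 0 < 1 - r by linarith)).eventually_ge_atTop C,
    eventually_gt_atTop 0] with t h1 h2
  calc C * t ^ r ≤ t ^ (1 - r) * t ^ r := by gcongr
    _ = t := by rw [← rpow_add h2, sub_add_cancel, rpow_one]

set_option maxHeartbeats 4000000 in
/-- The gap, the primal and the dual distance to the regularized saddle point are controlled by
`m ^ 2 * t ^ (3 * q + s + p - 2 + r)`. -/
theorem regularized_distance_le {f : X → ℝ} {f' : X → X}
    (hf : ∀ u, HasGradientAt f (f' u) u) (hconv : ConvexOn ℝ Set.univ f) (A : X →L[ℝ] Y) {b : Y}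
    {c p t₀ : ℝ} (hc : 0 < c) (hp0 : 0 < p) (hp1 : p < 1) (ht₀ : 0 < t₀)
    {xs : X} {ls : Y} (hA : A xs = b) (hmn : ∀ u, f xs ≤ f u + ⟪ls, A u - b⟫)
    {σ q γ s r : ℝ} (hσ : 0 < σ) (hq0 : 0 < q) (hq1 : q < 1) (hγ : 0 < γ) (hs : 0 < s)
    (hr0 : 0 ≤ r) (hr1 : r < 1) (hrp : p - q - s ≤ r)
    {m m' m'' : ℝ → ℝ} (hmpos : ∀ t ≥ t₀, 0 < m t)
    (hmd : ∀ t ≥ t₀, HasDerivAt m (m' t) t) (hmd2 : ∀ t ≥ t₀, HasDerivAt m' (m'' t) t)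
    {θ : ℝ → ℝ}
    (hθ : ∀ t, θ t = (m t * t ^ (2*q+s) + γ * t ^ q - 2 * m t * γ * q * t ^ (2*q-1)
      - γ * m' t * t ^ (2*q)) / (σ * (t ^ (q+s) - γ * q * t ^ (q-1))))
    {k₁ k₂ T₁ T₂ : ℝ} (hk₁ : 0 < k₁) (hk₂ : 0 < k₂)
    (hA1 : ∀ t ≥ T₁, γ / t ^ (q+s) ≤ m t ∧ m t ≤ k₁ / t ^ q)
    (hA2 : ∀ t ≥ T₂, t * |m' t| ≤ k₂ * m t ∧ t ^ 2 * |m'' t| ≤ k₂ * m t)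
    {x g : ℝ → X} {lam : ℝ → Y} {x' x'' : ℝ → X} {lam' : ℝ → Y} {gder : ℝ → X}
    (hg : ∀ t, g t = f' (x t) + ContinuousLinearMap.adjoint A (lam t) + (c / t ^ p) • x t)
    (hx : ∀ t ≥ t₀, HasDerivAt x (x' t) t) (hx' : ∀ t ≥ t₀, HasDerivAt x' (x'' t) t)
    (hlam : ∀ t ≥ t₀, HasDerivAt lam (lam' t) t) (hgder : ∀ t ≥ t₀, HasDerivAt g (gder t) t)
    (hode1 : ∀ t ≥ t₀, m t • x'' t + ((σ + 1) / t ^ q) • x' t + γ • gder t + t ^ s • g t = 0)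
    (hode2 : ∀ t ≥ t₀, lam' t = (σ * (t ^ (q+s) - γ * q * t ^ (q-1)))
      • (A (x t + θ t • x' t) - b - (c / t ^ p) • lam t))
    {xt : ℝ → X} {lt : ℝ → Y}
    (hsaddle : ∀ t ≥ t₀,
      f' (xt t) + ContinuousLinearMap.adjoint A (lt t) + (c / t ^ p) • xt t = 0 ∧
      A (xt t) - b - (c / t ^ p) • lt t = 0)
    {xt' : ℝ → X} {lt' : ℝ → Y} (hxt : ∀ t ≥ t₀, HasDerivAt xt (xt' t) t)
    (hlt : ∀ t ≥ t₀, HasDerivAt lt (lt' t) t) :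
    ∃ D > 0, ∀ᶠ t in atTop,
      f (x t) - f (xt t) + ⟪lt t, A (x t - xt t)⟫ + c / t ^ p / 2 * (‖x t‖ ^ 2 - ‖xt t‖ ^ 2) ≤
        D * (m t ^ 2 * t ^ (3*q+s+p-2+r)) ∧
      ‖x t - xt t‖ ^ 2 + ‖lam t - lt t‖ ^ 2 ≤ D * (m t ^ 2 * t ^ (3*q+s+p-2+r)) := by
  set R := √(‖xs‖ ^ 2 + ‖ls‖ ^ 2) with hRdef
  have hR0 : 0 ≤ R := Real.sqrt_nonneg _
  have hR2 : R ^ 2 = ‖xs‖ ^ 2 + ‖ls‖ ^ 2 := Real.sq_sqrt (by positivity)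
  obtain ⟨κ, hκ, C, hC, hdiss⟩ := dissipation_le hσ hc hγ hp0.le (mul_nonneg hp0.le hR0)
    (norm_nonneg A) hR0
  obtain ⟨K, hK, hen⟩ := energy_le_dissipation hσ hγ hk₁
  obtain ⟨T₃, hcoef⟩ := coefficient_bounds hq0 hq1 hs hγ hk₁ hk₂ hσ hc
  set n : ℝ → ℝ := fun t => m t * t ^ q with hn
  set n1 : ℝ → ℝ := fun t => m' t * t ^ q + m t * (q * t ^ (q - 1)) with hn1
  set β : ℝ → ℝ := fun t => t ^ (q + s) - γ * q * t ^ (q - 1) with hβ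
  set G : ℝ → ℝ := fun t => γ * t ^ q with hG
  set a : ℝ → ℝ := fun t => n t * β t + G t * (1 - n1 t) with ha
  set ε : ℝ → ℝ := fun t => c / t ^ p with hε
  set e := q + s + p - 2 + r with he
  set W : ℝ → ℝ := fun t => n t ^ 2 * t ^ e with hW
  set En : ℝ → ℝ := fun τ => a τ * (f (x τ) - f (xt τ) + ⟪lt τ, A (x τ - xt τ)⟫
        + ε τ / 2 * (‖x τ‖ ^ 2 - ‖xt τ‖ ^ 2))
      + (‖σ • (x τ - xt τ) + n τ • x' τ + G τ • g τ‖ ^ 2 + ‖lam τ - lt τ‖ ^ 2) / 2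
      + σ / 2 * (1 - n1 τ) * ‖x τ - xt τ‖ ^ 2 with hEn
  set C₄ := 2 * (k₂ + q) + |e| with hC₄
  have hC₄0 : 0 ≤ C₄ := by rw [hC₄]; positivity
  obtain ⟨T₄, hslow⟩ := eventually_atTop.1 (rpow_mul_le_eventually (C := 2 * C₄ * K / κ) hr1)
  set T := max (max (max t₀ 1) (max T₁ T₂)) (max T₃ T₄) with hT
  have hTt₀ : t₀ ≤ T := (le_max_left _ _).trans ((le_max_left _ _).trans (le_max_left _ _))
  have hT1 : 1 ≤ T := (le_max_right _ _).trans ((le_max_left _ _).trans (le_max_left _ _))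
  have hTT₁ : T₁ ≤ T := (le_max_left _ _).trans ((le_max_right _ _).trans (le_max_left _ _))
  have hTT₂ : T₂ ≤ T := (le_max_right _ _).trans ((le_max_right _ _).trans (le_max_left _ _))
  have hTT₃ : T₃ ≤ T := (le_max_left _ _).trans (le_max_right _ _)
  have hTT₄ : T₄ ≤ T := (le_max_right _ _).trans (le_max_right _ _)
  clear_value T
  have epos : ∀ t ≥ T, 0 < t := fun t ht => by linarith
  have eqs : ∀ t ≥ T, t ^ (q + s) = t ^ q * t ^ s := fun t ht => rpow_add (epos t ht) _ _
  have eq1 : ∀ t ≥ T, t ^ (q - 1) = t ^ q / t := fun t ht => rpow_sub_one (epos t ht).ne' _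
  have eq2 : ∀ t ≥ T, t ^ (q - 1 - 1) = t ^ q / t ^ 2 := fun t ht => by
    rw [rpow_sub_one (epos t ht).ne', eq1 t ht, div_div, sq]
  have eqs1 : ∀ t ≥ T, t ^ (q + s - 1) = t ^ q * t ^ s / t := fun t ht => by
    rw [rpow_sub_one (epos t ht).ne', eqs t ht]
  have ee : ∀ t ≥ T, t ^ e = t ^ q * t ^ s * t ^ p / t ^ 2 * t ^ r := fun t ht => by
    have h0 := epos t ht
    rw [he, rpow_add h0, rpow_sub h0, rpow_add h0, rpow_add h0, rpow_two]
  have one_q : ∀ t ≥ T, 1 ≤ t ^ q := fun t ht => one_le_rpow (by linarith) hq0.le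
  have one_s : ∀ t ≥ T, 1 ≤ t ^ s := fun t ht => one_le_rpow (by linarith) hs.le
  have one_p : ∀ t ≥ T, 1 ≤ t ^ p := fun t ht => one_le_rpow (by linarith) hp0.le
  have one_r : ∀ t ≥ T, 1 ≤ t ^ r := fun t ht => one_le_rpow (by linarith) hr0
  have p_le : ∀ t ≥ T, t ^ p ≤ t := fun t ht => by
    simpa using rpow_le_rpow_of_exponent_le (show 1 ≤ t by linarith) hp1.le
  have p_le' : ∀ t ≥ T, t ^ p ≤ t ^ r * (t ^ q * t ^ s) := fun t ht => by
    rw [← eqs t ht, ← rpow_add (epos t ht)]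
    exact rpow_le_rpow_of_exponent_le (by linarith) (by linarith)
  have m_pos : ∀ t ≥ T, 0 < m t := fun t ht => hmpos t (hTt₀.trans ht)
  have n_low : ∀ t ≥ T, γ ≤ n t * t ^ s := fun t ht => by
    have h1 := (hA1 t (hTT₁.trans ht)).1
    rw [div_le_iff₀ (rpow_pos_of_pos (epos t ht) _), eqs t ht] at h1
    rw [hn]; linarith
  have hsq : ∀ t ≥ t₀, ‖xt t‖ ^ 2 + ‖lt t‖ ^ 2 ≤ R ^ 2 := fun t ht => by
    rw [hR2]
    exact norm_sq_regularized_saddle_le hf hconv A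
      (div_pos hc (rpow_pos_of_pos (ht₀.trans_le ht) _)) hA hmn (hsaddle t ht).1 (hsaddle t ht).2
  have dε : ∀ t ≥ t₀, HasDerivAt ε (-(p / t * ε t)) t := fun t ht => by
    have h0 : 0 < t := ht₀.trans_le ht
    have h1 := (hasDerivAt_const t c).div (hasDerivAt_rpow_const (p := p) (Or.inl h0.ne'))
      (rpow_pos_of_pos h0 p).ne'
    refine h1.congr_deriv ?_
    rw [rpow_sub_one h0.ne', hε]
    have := (rpow_pos_of_pos h0 p).ne'
    field_simp
    ring
  have hvel : ∀ t ≥ t₀, ‖xt' t‖ ^ 2 + ‖lt' t‖ ^ 2 ≤ (p * R / t) ^ 2 := fun t ht => by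
    have h0 : 0 < t := ht₀.trans_le ht
    have h1 := norm_sq_deriv_regularized_saddle_le hf hconv A (ε := ε) (δ := p / t)
      (by positivity) (div_pos hc (rpow_pos_of_pos h0 _)) (fun τ hτ => hsaddle τ (ht.le.trans hτ))
      (dε t ht) (hxt t ht) (hlt t ht) (hsq t ht)
    calc _ ≤ _ := h1
      _ = _ := by ring
  set n2 : ℝ → ℝ := fun t => m'' t * t ^ q + 2 * (m' t * (q * (t ^ q / t)))
    + m t * (q * ((q - 1) * (t ^ q / t ^ 2))) with hn2
  set β1 : ℝ → ℝ := fun t => (q + s) * (t ^ q * t ^ s / t) - γ * q * ((q - 1) * (t ^ q / t ^ 2))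
    with hβ1
  have hco := fun t (ht : t ≥ T) => hcoef t (t ^ q) (t ^ s) (t ^ p) (m t) (m' t) (m'' t)
    (hTT₃.trans ht) (hT1.trans ht) (one_q t ht) (one_s t ht) (one_p t ht) (p_le t ht) (m_pos t ht)
    (hA1 t (hTT₁.trans ht)).2 (hA2 t (hTT₂.trans ht)).1 (hA2 t (hTT₂.trans ht)).2
    (n t) (n1 t) (n2 t) (β t) (β1 t) rfl (by rw [hn1]; simp only; rw [eq1 t ht]) rfl
    (by rw [hβ]; simp only; rw [eqs t ht, eq1 t ht]) rfl
  have drq : ∀ t ≥ T, HasDerivAt (fun t : ℝ => t ^ q) (q * t ^ (q - 1)) t := fun t ht =>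
    hasDerivAt_rpow_const (Or.inl (epos t ht).ne')
  have drq1 : ∀ t ≥ T, HasDerivAt (fun t : ℝ => t ^ (q - 1)) ((q - 1) * t ^ (q - 1 - 1)) t :=
    fun t ht => hasDerivAt_rpow_const (Or.inl (epos t ht).ne')
  have drqs : ∀ t ≥ T, HasDerivAt (fun t : ℝ => t ^ (q + s)) ((q + s) * t ^ (q + s - 1)) t :=
    fun t ht => hasDerivAt_rpow_const (Or.inl (epos t ht).ne')
  have dn : ∀ t ≥ T, HasDerivAt n (n1 t) t := fun t ht =>
    (hmd t (hTt₀.trans ht)).mul (drq t ht)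
  have dn1 : ∀ t ≥ T, HasDerivAt n1 (n2 t) t := fun t ht => by
    refine (((hmd2 t (hTt₀.trans ht)).mul (drq t ht)).add ((hmd t (hTt₀.trans ht)).mul
      ((drq1 t ht).const_mul q))).congr_deriv ?_
    rw [hn2]
    simp only
    rw [eq1 t ht, eq2 t ht]; ring
  have dG : ∀ t ≥ T, HasDerivAt G (γ * (q * (t ^ q / t))) t := fun t ht => by
    rw [← eq1 t ht]; exact (drq t ht).const_mul γ
  have dβ : ∀ t ≥ T, HasDerivAt β (β1 t) t := fun t ht => by
    refine ((drqs t ht).sub ((drq1 t ht).const_mul (γ * q))).congr_deriv ?_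
    rw [hβ1]
    simp only
    rw [eqs1 t ht, eq2 t ht]
  have da : ∀ t ≥ T, HasDerivAt a (n1 t * β t + n t * β1 t
      + (γ * (q * (t ^ q / t)) * (1 - n1 t) - γ * t ^ q * n2 t)) t := fun t ht => by
    refine (((dn t ht).mul (dβ t ht)).add ((dG t ht).mul ((dn1 t ht).const_sub 1))).congr_deriv ?_
    rw [hG]; ring
  have hn0 : ∀ t ≥ T, 0 < n t := fun t ht =>
    mul_pos (m_pos t ht) (rpow_pos_of_pos (epos t ht) _)
  have hβ0 : ∀ t ≥ T, 0 < β t := fun t ht => by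
    obtain ⟨-, -, -, h, -⟩ := hco t ht
    have h1 := one_q t ht
    have h2 := one_s t ht
    have : 0 < t ^ q * t ^ s := by positivity
    linarith
  have haθ : ∀ t ≥ T, a t = σ * β t * θ t := fun t ht => by
    have h0 := epos t ht
    have h1 : σ * β t ≠ 0 := (mul_pos hσ (hβ0 t ht)).ne'
    rw [hθ t, mul_div_cancel₀ _ h1]
    simp only [ha, hn, hn1, hβ, hG]
    have e1 : t ^ (2 * q + s) = t ^ q * (t ^ q * t ^ s) := by
      rw [← rpow_add h0, ← rpow_add h0]; ring_nf
    have e2 : t ^ (2 * q - 1) = t ^ q * (t ^ q / t) := by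
      rw [← eq1 t ht, ← rpow_add h0]; ring_nf
    have e3 : t ^ (2 * q) = t ^ q * t ^ q := by rw [← rpow_add h0]; ring_nf
    rw [e1, e2, e3, eqs t ht, eq1 t ht]; ring
  have ha_low : ∀ t ≥ T, γ / 2 ≤ a t := fun t ht => by
    obtain ⟨-, -, h, -⟩ := hco t ht
    have h1 := abs_le.1 h
    have h2 : γ * 1 * (1 / 2) ≤ G t * (1 - n1 t) := by
      have := one_q t ht
      simp only [hG]
      have h3 : (1 : ℝ) / 2 ≤ 1 - n1 t := by linarith
      gcongr
    have h4 := mul_pos (hn0 t ht) (hβ0 t ht)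
    rw [ha]; simp only; linarith
  have hode : ∀ t ≥ T, n t • x'' t + (σ + 1) • x' t + G t • gder t
      + (β t + γ * (q * (t ^ q / t))) • g t = 0 := fun t ht => by
    have h1 := congrArg (fun v => t ^ q • v) (hode1 t (hTt₀.trans ht))
    simp only [smul_add, smul_smul, smul_zero] at h1
    have h2 : t ^ q * ((σ + 1) / t ^ q) = σ + 1 :=
      mul_div_cancel₀ _ (rpow_pos_of_pos (epos t ht) _).ne'
    rw [h2] at h1
    have h3 : β t + γ * (q * (t ^ q / t)) = t ^ q * t ^ s := by
      rw [hβ]; simp only; rw [eqs t ht, eq1 t ht]; ring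
    rw [h3, ← h1, hn, hG]
    simp only [mul_comm]
  have hgap := fun t (ht : t ≥ T) =>
    regularized_gap_lower hf hconv A (u := x t) (hsaddle t (hTt₀.trans ht)).1
  have hgap0 : ∀ t ≥ T, 0 ≤ f (x t) - f (xt t) + ⟪lt t, A (x t - xt t)⟫
      + ε t / 2 * (‖x t‖ ^ 2 - ‖xt t‖ ^ 2) := fun t ht => by
    have := rpow_pos_of_pos (epos t ht) p
    exact (hgap t ht).trans' (by positivity)
  have dW : ∀ t ≥ T, HasDerivAt W (2 * n t * n1 t * t ^ e + n t ^ 2 * (e * t ^ (e - 1))) t :=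
    fun t ht => by
    refine (((dn t ht).pow 2).mul (hasDerivAt_rpow_const (p := e)
      (Or.inl (epos t ht).ne'))).congr_deriv ?_
    simp
  have W_pos : ∀ t ≥ T, 0 < W t := fun t ht =>
    mul_pos (pow_pos (hn0 t ht) 2) (rpow_pos_of_pos (epos t ht) _)
  have hcomp : ∃ D, 0 < D ∧ ∀ t ≥ T, En t ≤ D * W t := by
    refine exists_le_const_mul_of_deriv_le (K := κ / K) (C := C) (ρ := fun t => (t ^ r)⁻¹)
      (by positivity) (fun t ht => inv_pos.2 (rpow_pos_of_pos (epos t ht) _)) W_pos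
      (fun t ht => hasDerivAt_energy (β := β t) hf A (hx t (hTt₀.trans ht)) (hx' t (hTt₀.trans ht))
        (hgder t (hTt₀.trans ht)) (hxt t (hTt₀.trans ht)) (hlam t (hTt₀.trans ht))
        (hlt t (hTt₀.trans ht)) (dε t (hTt₀.trans ht)) (da t ht) (dn t ht) (dn1 t ht) (dG t ht)
        (hode t ht)) dW ?_ ?_
    · intro t ht
      have ht0 := hTt₀.trans ht
      have h0 := epos t ht
      obtain ⟨hnk, -, hn1h, hβl, hβu, ha1, hn2u⟩ := hco t ht
      have hlam't : lam' t - lt' t = (σ * β t) • (A (x t - xt t) + θ t • A (x' t)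
          - ε t • (lam t - lt t)) - lt' t := by
        rw [hode2 t ht0]
        have h1 : A (xt t) = b + ε t • lt t := by
          have := (hsaddle t ht0).2
          rw [sub_sub, sub_eq_zero] at this; exact this
        have h2 : A (x t + θ t • x' t) - b - (c / t ^ p) • lam t =
            A (x t - xt t) + θ t • A (x' t) - ε t • (lam t - lt t) := by
          rw [map_add, map_smul, map_sub, h1]; module
        rw [h2]
      have hRt0 : 0 ≤ p * R / t := by positivity
      have hvelt := hvel t ht0
      have hy : ‖xt' t‖ ≤ p * R / t :=
        (pow_le_pow_iff_left₀ (norm_nonneg _) hRt0 two_ne_zero).1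
          (by linarith [sq_nonneg ‖lt' t‖])
      have hη : ‖lt' t‖ ≤ p * R / t :=
        (pow_le_pow_iff_left₀ (norm_nonneg _) hRt0 two_ne_zero).1
          (by linarith [sq_nonneg ‖xt' t‖])
      have hzR : ‖xt t‖ ≤ R :=
        (pow_le_pow_iff_left₀ (norm_nonneg _) hR0 two_ne_zero).1
          (by linarith [sq_nonneg ‖lt t‖, hsq t ht0])
      have hGpos : 0 ≤ G t := mul_nonneg hγ.le (rpow_pos_of_pos h0 _).le
      have hεpos : 0 ≤ ε t := div_nonneg hc.le (rpow_pos_of_pos h0 _).le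
      rw [hlam't]
      have m1 := energy_deriv_le (n2 := n2 t) (a1 := n1 t * β t + n t * β1 t
          + (γ * (q * (t ^ q / t)) * (1 - n1 t) - γ * t ^ q * n2 t)) (v := x' t) hf hconv A
        (hg t) (hsaddle t ht0).1 (haθ t ht) rfl rfl rfl
        ((ha_low t ht).trans' (by positivity)) (hβ0 t ht).le hσ.le (hn0 t ht).le hGpos hεpos
        (div_nonneg hp0.le h0.le) hn1h hy hη hzR
      have m2 := hdiss t (t ^ q) (t ^ s) (t ^ p) (n t) (n1 t) (β t) (a t) (n1 t * β t + n t * β1 t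
          + (γ * (q * (t ^ q / t)) * (1 - n1 t) - γ * t ^ q * n2 t)) (n2 t)
        (f (x t) - f (xt t) + ⟪lt t, A (x t - xt t)⟫
          + ε t / 2 * (‖x t‖ ^ 2 - ‖xt t‖ ^ 2))
        ‖x t - xt t‖
        ‖lam t - lt t‖ ‖x' t‖ ‖g t‖ (hT1.trans ht) (one_q t ht) (one_s t ht) (one_p t ht)
        (n_low t ht) hn1h hβl hβu rfl ha1 hn2u (hgap0 t ht) (norm_nonneg _) (norm_nonneg _)
        (norm_nonneg _) (norm_nonneg _)
      have m3 := hen (t ^ q) (t ^ s) (t ^ p) (t ^ r) (n t) (n1 t) (β t) (a t)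
        (f (x t) - f (xt t) + ⟪lt t, A (x t - xt t)⟫
          + ε t / 2 * (‖x t‖ ^ 2 - ‖xt t‖ ^ 2))
        ‖x t - xt t‖
        ‖lam t - lt t‖ ‖x' t‖ ‖g t‖ ‖σ • (x t - xt t) + n t • x' t + G t • g t‖
        (one_q t ht) (one_s t ht) (one_p t ht) (one_r t ht) (p_le' t ht)
        (n_low t ht) hnk hn1h (hβ0 t ht).le hβu rfl (hgap0 t ht) (norm_nonneg _)
        (norm_nonneg _) (norm_nonneg _) (norm_nonneg _) (by
          refine norm_add₃_le.trans (le_of_eq ?_)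
          rw [norm_smul, norm_smul, norm_smul, Real.norm_of_nonneg hσ.le,
            Real.norm_of_nonneg (hn0 t ht).le, Real.norm_of_nonneg hGpos])
      refine m1.trans (m2.trans ?_)
      have h5 : (t ^ r)⁻¹ * W t = n t ^ 2 * (t ^ q * t ^ s) * t ^ p / t ^ 2 := by
        have := (rpow_pos_of_pos h0 r).ne'
        rw [hW]
        simp only
        rw [ee t ht]; field_simp
      rw [h5]
      have hr0' := rpow_pos_of_pos h0 r
      have hcancel : ∀ S : ℝ, κ / K * (t ^ r)⁻¹ * (K * (t ^ r * S)) = κ * S := by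
        intro S; field_simp
      have h6 : κ / K * (t ^ r)⁻¹ * En t ≤ _ :=
        mul_le_mul_of_nonneg_left m3 (show 0 ≤ κ / K * (t ^ r)⁻¹ by positivity)
      rw [hcancel] at h6
      linarith
    · intro t ht
      have h0 := epos t ht
      obtain ⟨-, hn1u, -⟩ := hco t ht
      have h1 := hslow t (hTT₄.trans ht)
      have hr0' := rpow_pos_of_pos h0 r
      have he0 := rpow_pos_of_pos h0 e
      have hnp := hn0 t ht
      have h2 : C₄ / t ≤ κ / K / 2 * (t ^ r)⁻¹ := by
        rw [div_le_iff₀ h0]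
        have h3 : κ / K / 2 * (t ^ r)⁻¹ * (2 * C₄ * K / κ * t ^ r) = C₄ := by field_simp
        calc C₄ = κ / K / 2 * (t ^ r)⁻¹ * (2 * C₄ * K / κ * t ^ r) := h3.symm
          _ ≤ κ / K / 2 * (t ^ r)⁻¹ * t := by gcongr
      have h4 : -(C₄ / t * W t) ≤ 2 * n t * n1 t * t ^ e + n t ^ 2 * (e * t ^ (e - 1)) := by
        have h5 : -n1 t ≤ (k₂ + q) * (n t / t) := (neg_le_abs _).trans hn1u
        have h6 : 2 * n t * -n1 t * t ^ e ≤ 2 * n t * ((k₂ + q) * (n t / t)) * t ^ e := by gcongr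
        have h7 : n t ^ 2 * (-e * (t ^ e / t)) ≤ n t ^ 2 * (|e| * (t ^ e / t)) := by
          gcongr; exact neg_le_abs e
        have h8 : C₄ / t * W t = 2 * n t * ((k₂ + q) * (n t / t)) * t ^ e
            + n t ^ 2 * (|e| * (t ^ e / t)) := by
          rw [hC₄, hW]; ring
        rw [rpow_sub_one h0.ne', h8]
        linarith
      have h9 := mul_le_mul_of_nonneg_right h2 (W_pos t ht).le
      linarith
  obtain ⟨D, hD, hDW⟩ := hcomp
  refine ⟨max (D * (2 / γ)) (D * (4 / σ + 2)), by positivity, ?_⟩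
  filter_upwards [eventually_ge_atTop T] with t ht
  have h0 := epos t ht
  obtain ⟨-, -, hn1h, -⟩ := hco t ht
  have hn1h' := (abs_le.1 hn1h).2
  have hWQ : W t = m t ^ 2 * t ^ (3*q+s+p-2+r) := by
    have : t ^ (3*q+s+p-2+r) = t ^ q * t ^ q * t ^ e := by
      rw [← rpow_add h0, ← rpow_add h0, he]; ring_nf
    rw [this, hW, hn]; ring
  rw [← hWQ]
  have hE := hDW t ht
  have hΦ := hgap0 t ht
  have hWp := W_pos t ht
  have hΦa := mul_le_mul_of_nonneg_right (ha_low t ht) hΦ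
  have s1 : 0 ≤ ‖σ • (x t - xt t) + n t • x' t + G t • g t‖ ^ 2 := sq_nonneg _
  have s2 : 0 ≤ ‖lam t - lt t‖ ^ 2 := sq_nonneg _
  have s3 : σ / 4 * ‖x t - xt t‖ ^ 2 ≤ σ / 2 * (1 - n1 t) * ‖x t - xt t‖ ^ 2 := by
    have : σ / 2 * (1 / 2) * ‖x t - xt t‖ ^ 2 ≤ σ / 2 * (1 - n1 t) * ‖x t - xt t‖ ^ 2 := by
      gcongr; linarith
    linarith
  have s4 : 0 ≤ σ / 4 * ‖x t - xt t‖ ^ 2 := by positivity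
  simp only [hEn] at hE
  constructor
  · have h1 : γ / 2 * (f (x t) - f (xt t) + ⟪lt t, A (x t - xt t)⟫
      + ε t / 2 * (‖x t‖ ^ 2 - ‖xt t‖ ^ 2)) ≤ D * W t := by
      linarith [mul_nonneg (show 0 ≤ γ / 2 by positivity) hΦ]
    calc f (x t) - f (xt t) + ⟪lt t, A (x t - xt t)⟫ + ε t / 2 * (‖x t‖ ^ 2 - ‖xt t‖ ^ 2)
        = 2 / γ * (γ / 2 * (f (x t) - f (xt t) + ⟪lt t, A (x t - xt t)⟫
              + ε t / 2 * (‖x t‖ ^ 2 - ‖xt t‖ ^ 2))) := by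
          rw [← mul_assoc, show 2 / γ * (γ / 2) = 1 by field_simp, one_mul]
      _ ≤ 2 / γ * (D * W t) := by gcongr
      _ = D * (2 / γ) * W t := by ring
      _ ≤ _ := by gcongr; exact le_max_left _ _
  · have ha0 := mul_nonneg (show 0 ≤ γ / 2 by positivity) hΦ
    have h1 : σ / 4 * ‖x t - xt t‖ ^ 2 ≤ D * W t := by linarith
    have h2 : ‖lam t - lt t‖ ^ 2 ≤ 2 * (D * W t) := by linarith
    calc _ = 4 / σ * (σ / 4 * ‖x t - xt t‖ ^ 2) + ‖lam t - lt t‖ ^ 2 := by field_simp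
      _ ≤ 4 / σ * (D * W t) + 2 * (D * W t) := by gcongr
      _ = D * (4 / σ + 2) * W t := by ring
      _ ≤ _ := by gcongr; exact le_max_right _ _

end Rates

theorem rates_case_large_p
    {X Y : Type*} [NormedAddCommGroup X] [InnerProductSpace ℝ X] [CompleteSpace X]
    [NormedAddCommGroup Y] [InnerProductSpace ℝ Y] [CompleteSpace Y]
    (f : X → ℝ) (f' : X → X) (hf : ∀ u, HasGradientAt f (f' u) u)
    (hconv : ConvexOn ℝ Set.univ f)
    (A : X →L[ℝ] Y) (b : Y)
    (L : X → Y → ℝ) (hL : ∀ u lam, L u lam = f u + ⟪lam, A u - b⟫)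
    (c p t₀ : ℝ) (hc : 0 < c) (hp0 : 0 < p) (hp1 : p < 1) (ht₀ : 0 < t₀)
    (Lt : ℝ → X → Y → ℝ)
    (hLt : ∀ t u lam, Lt t u lam = L u lam + (c / (2 * t ^ p)) * (‖u‖ ^ 2 - ‖lam‖ ^ 2))
    (gx : ℝ → X → Y → X)
    (hgx : ∀ t u lam, gx t u lam = f' u + ContinuousLinearMap.adjoint A lam + (c / t ^ p) • u)
    (gl : ℝ → X → Y → Y)
    (hgl : ∀ t u lam, gl t u lam = A u - b - (c / t ^ p) • lam)
    (Om : Set (X × Y))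
    (hOm : Om = {z : X × Y | ∀ u μ, L z.1 μ ≤ L z.1 z.2 ∧ L z.1 z.2 ≤ L u z.2})
    (hOmne : Om.Nonempty)
    (xs : X) (ls : Y)
    (hmem : (xs, ls) ∈ Om)
    (hmin : ∀ w ∈ Om, Real.sqrt (‖xs‖ ^ 2 + ‖ls‖ ^ 2) ≤ Real.sqrt (‖w.1‖ ^ 2 + ‖w.2‖ ^ 2))
    (α q γ s : ℝ) (hα : 1 < α) (hq0 : 0 < q) (hq1 : q < 1) (hγ : 0 < γ) (hs : 0 < s)
    (m m' m'' : ℝ → ℝ)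
    (hmpos : ∀ t ≥ t₀, 0 < m t)
    (hmmono : AntitoneOn m (Set.Ici t₀))
    (hmd : ∀ t ≥ t₀, HasDerivAt m (m' t) t)
    (hmd2 : ∀ t ≥ t₀, HasDerivAt m' (m'' t) t)
    (θ : ℝ → ℝ)
    (hθ : ∀ t, θ t = (m t * t ^ (2*q+s) + γ * t ^ q - 2 * m t * γ * q * t ^ (2*q-1)
      - γ * m' t * t ^ (2*q)) / ((α - 1) * (t ^ (q+s) - γ * q * t ^ (q-1))))
    (k₁ k₂ T₁ T₂ : ℝ) (hk₁ : 0 < k₁) (hk₂ : 0 < k₂) (hT₁ : t₀ ≤ T₁) (hT₂ : t₀ ≤ T₂)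
    (hA1 : ∀ t ≥ T₁, γ / t ^ (q+s) ≤ m t ∧ m t ≤ k₁ / t ^ q)
    (hA2 : ∀ t ≥ T₂, t * |m' t| ≤ k₂ * m t ∧ t ^ 2 * |m'' t| ≤ k₂ * m t)
    (x : ℝ → X) (lam : ℝ → Y) (x' x'' : ℝ → X) (lam' : ℝ → Y) (gder : ℝ → X)
    (hx : ∀ t ≥ t₀, HasDerivAt x (x' t) t)
    (hx' : ∀ t ≥ t₀, HasDerivAt x' (x'' t) t)
    (hx''c : ContinuousOn x'' (Set.Ici t₀))
    (hlam : ∀ t ≥ t₀, HasDerivAt lam (lam' t) t)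
    (hlamc : ContinuousOn lam' (Set.Ici t₀))
    (hgder : ∀ t ≥ t₀, HasDerivAt (fun τ => gx τ (x τ) (lam τ)) (gder t) t)
    (hode1 : ∀ t ≥ t₀, m t • x'' t + (α / t ^ q) • x' t + γ • gder t
      + t ^ s • gx t (x t) (lam t) = 0)
    (hode2 : ∀ t ≥ t₀, lam' t = ((α - 1) * (t ^ (q+s) - γ * q * t ^ (q-1)))
      • gl t (x t + θ t • x' t) (lam t))
    (xt : ℝ → X) (lt : ℝ → Y)
    (hsaddle : ∀ t ≥ t₀, gx t (xt t) (lt t) = 0 ∧ gl t (xt t) (lt t) = 0)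
    (xt' : ℝ → X) (lt' : ℝ → Y)
    (hxt : ∀ t ≥ t₀, HasDerivAt xt (xt' t) t)
    (hlt : ∀ t ≥ t₀, HasDerivAt lt (lt' t) t)
    (hxtc : ContinuousOn xt' (Set.Ici t₀))
    (hltc : ContinuousOn lt' (Set.Ici t₀))
    (r : ℝ) (hr : r = max q (p - q - s))
    (hp2 : (1 - q)/2 ≤ p) (hpq : p < 1 - q)
    (hcond1 : 4*q + s + p - 2 < 0) (hcond2 : 3*q + s - p - 1 < 0)
    :
    ((fun t => L (x t) ls - L xs ls) =O[atTop]
        (fun t => Real.sqrt (m t) * t ^ ((3*q+s+p-2+r)/2) + t ^ (-p)))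
    ∧ ((fun t => |f (x t) - f xs|) =O[atTop]
        (fun t => Real.sqrt (m t) * t ^ ((3*q+s+p-2+r)/2) + t ^ (-p)))
    ∧ ((fun t => ‖A (x t) - b‖) =O[atTop]
        (fun t => Real.sqrt (m t) * t ^ ((3*q+s+p-2+r)/2) + t ^ (-p)))
    ∧ ((fun t => ‖x t - xt t‖ ^ 2 + ‖lam t - lt t‖ ^ 2) =O[atTop]
        (fun t => m t * t ^ (3*q+s+p-2+r))) := by
  have hOm' : ∀ u μ, L xs μ ≤ L xs ls ∧ L xs ls ≤ L u ls := by
    rw [hOm] at hmem; exact hmem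
  have hA : A xs = b := by
    refine sub_eq_zero.1 (apply_eq_of_forall_inner_le (l := ls) fun μ => ?_)
    have := (hOm' xs μ).1
    rw [hL, hL] at this
    linarith
  have hmn : ∀ u, f xs ≤ f u + ⟪ls, A u - b⟫ := fun u => by
    have := (hOm' u ls).2
    rwa [hL, hL, hA, sub_self, inner_zero_right, add_zero] at this
  have hrq : q ≤ r := hr ▸ le_max_left _ _
  have hrp : p - q - s ≤ r := hr ▸ le_max_right _ _
  have hr1 : r < 1 := hr ▸ max_lt hq1 (by linarith)
  have hre : 2 * q + s + p - 2 + r ≤ 0 := by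
    rcases le_total q (p - q - s) with h | h
    · rw [hr, max_eq_right h]; linarith
    · rw [hr, max_eq_left h]; linarith
  have hsaddle' : ∀ t ≥ t₀,
      f' (xt t) + ContinuousLinearMap.adjoint A (lt t) + (c / t ^ p) • xt t = 0 ∧
      A (xt t) - b - (c / t ^ p) • lt t = 0 := fun t ht => by
    rw [← hgx, ← hgl]; exact hsaddle t ht
  obtain ⟨D, hD, hdist⟩ := regularized_distance_le hf hconv A hc hp0 hp1 ht₀ hA hmn
    (sub_pos.2 hα) hq0 hq1 hγ hs (hq0.le.trans hrq) hr1 hrp hmpos hmd hmd2 hθ hk₁ hk₂ hA1 hA2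
    (g := fun t => gx t (x t) (lam t)) (fun t => hgx t _ _) hx hx' hlam hgder
    (fun t ht => by rw [sub_add_cancel]; exact hode1 t ht)
    (fun t ht => by rw [hode2 t ht, hgl]) hsaddle' hxt hlt
  set Q : ℝ → ℝ := fun t => m t * t ^ (3*q+s+p-2+r) with hQ
  set S : ℝ → ℝ := fun t => √(m t) * t ^ ((3*q+s+p-2+r)/2) with hS
  set R := √(‖xs‖ ^ 2 + ‖ls‖ ^ 2) with hR
  have hR2 : R ^ 2 = ‖xs‖ ^ 2 + ‖ls‖ ^ 2 := Real.sq_sqrt (by positivity)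
  have hR0 : 0 ≤ R := Real.sqrt_nonneg _
  have hxsR : ‖xs‖ ≤ R := Real.le_sqrt_of_sq_le (by linarith [sq_nonneg ‖ls‖])
  have hlsR : ‖ls‖ ≤ R := Real.le_sqrt_of_sq_le (by linarith [sq_nonneg ‖xs‖])
  have hDk : 0 < D * k₁ := mul_pos hD hk₁
  obtain ⟨C₁, hC₁⟩ : ∃ C₁, C₁ = D * k₁ * √k₁ + R * ‖A‖ * √(D * k₁)
        + c / 2 * (D * k₁ * √k₁ + 2 * R * √(D * k₁)) + c * R ^ 2 := ⟨_, rfl⟩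
  obtain ⟨C₂, hC₂⟩ : ∃ C₂, C₂ = ‖A‖ * √(D * k₁) + c * R := ⟨_, rfl⟩
  have main : ∀ᶠ t in atTop, 0 ≤ S t ∧ 0 < t ^ (-p) ∧
      |f (x t) - f xs| ≤ C₁ * (S t + t ^ (-p)) ∧
      ‖A (x t) - b‖ ≤ C₂ * (S t + t ^ (-p)) ∧ 0 ≤ Q t ∧
      ‖x t - xt t‖ ^ 2 + ‖lam t - lt t‖ ^ 2 ≤ D * k₁ * Q t := by
    filter_upwards [hdist, eventually_ge_atTop t₀, eventually_ge_atTop T₁, eventually_ge_atTop 1]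
      with t ⟨hgap, hd⟩ htt₀ htT₁ ht1
    have h0 : 0 < t := by linarith
    have hm0 := hmpos t htt₀
    have hmk := (hA1 t htT₁).2
    have hqp := rpow_pos_of_pos h0 q
    have hmk₁ : m t ≤ k₁ := hmk.trans (div_le_self hk₁.le (one_le_rpow ht1 hq0.le))
    have hep := rpow_pos_of_pos h0 (3*q+s+p-2+r)
    have hQ0 : 0 ≤ Q t := by positivity
    have hS0 : 0 ≤ S t := by positivity
    have hSQ : S t ^ 2 = Q t := by
      simp only [hS, hQ]
      rw [mul_pow, Real.sq_sqrt hm0.le, ← rpow_natCast, ← rpow_mul h0.le]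
      norm_num
    have hmQ : m t ^ 2 * t ^ (3*q+s+p-2+r) ≤ k₁ * Q t := by
      calc m t ^ 2 * t ^ (3*q+s+p-2+r) = m t * Q t := by simp only [hQ]; ring
        _ ≤ k₁ * Q t := by gcongr
    have hQk : Q t ≤ k₁ := by
      calc Q t ≤ k₁ / t ^ q * t ^ (3*q+s+p-2+r) := by simp only [hQ]; gcongr
        _ = k₁ * t ^ (2*q+s+p-2+r) := by
          rw [div_mul_eq_mul_div, mul_div_assoc, ← rpow_sub h0]; ring_nf
        _ ≤ k₁ * 1 := by gcongr; exact rpow_le_one_of_one_le_of_nonpos ht1 hre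
        _ = k₁ := mul_one _
    have hSk : S t ≤ √k₁ := Real.le_sqrt_of_sq_le (hSQ.trans_le hQk)
    have hQS : Q t ≤ √k₁ * S t := by rw [← hSQ, sq]; gcongr
    have hd' : ‖x t - xt t‖ ^ 2 + ‖lam t - lt t‖ ^ 2 ≤ D * k₁ * Q t :=
      hd.trans (by rw [mul_assoc]; gcongr)
    have hw2 : ‖x t - xt t‖ ^ 2 ≤ D * k₁ * Q t := by linarith [sq_nonneg ‖lam t - lt t‖]
    have hw : ‖x t - xt t‖ ≤ √(D * k₁) * S t := by
      refine (pow_le_pow_iff_left₀ (norm_nonneg _) (by positivity) two_ne_zero).1 ?_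
      rw [mul_pow, Real.sq_sqrt hDk.le, hSQ]; exact hw2
    have hw3 : ‖x t - xt t‖ ^ 2 ≤ D * k₁ * √k₁ * S t :=
      hw2.trans (by rw [mul_assoc (D * k₁)]; gcongr)
    have hgap' : f (x t) - f (xt t) + ⟪lt t, A (x t - xt t)⟫
        + c / t ^ p / 2 * (‖x t‖ ^ 2 - ‖xt t‖ ^ 2) ≤ D * k₁ * √k₁ * S t :=
      calc _ ≤ D * (m t ^ 2 * t ^ (3*q+s+p-2+r)) := hgap
        _ ≤ D * (k₁ * (√k₁ * S t)) := 
          mul_le_mul_of_nonneg_left (hmQ.trans (by gcongr)) hD.le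
        _ = _ := by ring
    have hpp := rpow_pos_of_pos h0 p
    have hε0 : 0 < c / t ^ p := div_pos hc hpp
    have hεc : c / t ^ p ≤ c := div_le_self hc.le (one_le_rpow ht1 hp0.le)
    have hεp : c / t ^ p = c * t ^ (-p) := by rw [rpow_neg h0.le, div_eq_mul_inv]
    have htp := rpow_pos_of_pos h0 (-p)
    have hsq := norm_sq_regularized_saddle_le hf hconv A hε0 hA hmn (hsaddle' t htt₀).1
      (hsaddle' t htt₀).2
    have hxtR : ‖xt t‖ ≤ R := Real.le_sqrt_of_sq_le (by linarith [sq_nonneg ‖lt t‖])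
    have hltR : ‖lt t‖ ≤ R := Real.le_sqrt_of_sq_le (by linarith [sq_nonneg ‖xt t‖])
    refine ⟨hS0, htp, ?_, ?_, hQ0, hd'⟩
    · have h1 := abs_objective_gap_le hf hconv A (u := x t) hε0.le hA hmn (hsaddle' t htt₀).1
        (hsaddle' t htt₀).2 hxtR hltR hxsR hlsR
      have h2 : R * ‖A‖ * ‖x t - xt t‖ ≤ R * ‖A‖ * (√(D * k₁) * S t) := by gcongr
      have h3 : c / t ^ p / 2 * (‖x t - xt t‖ ^ 2 + 2 * R * ‖x t - xt t‖) ≤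
          c / 2 * (D * k₁ * √k₁ * S t + 2 * R * (√(D * k₁) * S t)) := by gcongr
      have h4 : c / t ^ p * R ^ 2 = c * R ^ 2 * t ^ (-p) := by rw [hεp]; ring
      have h5 : 0 ≤ (D * k₁ * √k₁ + R * ‖A‖ * √(D * k₁)
        + c / 2 * (D * k₁ * √k₁ + 2 * R * √(D * k₁))) * t ^ (-p) := by positivity
      have h6 : 0 ≤ c * R ^ 2 * S t := by positivity
      rw [hC₁]
      linarith
    · have h1 := norm_residual_le A (u := x t) hε0.le (hsaddle' t htt₀).2 hltR
      have h2 : ‖A‖ * ‖x t - xt t‖ ≤ ‖A‖ * (√(D * k₁) * S t) := by gcongr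
      have h3 : c / t ^ p * R = c * R * t ^ (-p) := by rw [hεp]; ring
      have h4 : 0 ≤ ‖A‖ * √(D * k₁) * t ^ (-p) := by positivity
      have h5 : 0 ≤ c * R * S t := by positivity
      rw [hC₂]
      linarith
  have hf_O : (fun t => |f (x t) - f xs|) =O[atTop] (fun t => S t + t ^ (-p)) := by
    refine IsBigO.of_bound C₁ (main.mono fun t h => ?_)
    obtain ⟨h1, h2, h3, -⟩ := h
    rwa [Real.norm_of_nonneg (abs_nonneg _), Real.norm_of_nonneg (add_nonneg h1 h2.le)]
  have hA_O : (fun t => ‖A (x t) - b‖) =O[atTop] (fun t => S t + t ^ (-p)) := by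
    refine IsBigO.of_bound C₂ (main.mono fun t h => ?_)
    obtain ⟨h1, h2, -, h4, -⟩ := h
    rwa [Real.norm_of_nonneg (norm_nonneg _), Real.norm_of_nonneg (add_nonneg h1 h2.le)]
  refine ⟨?_, hf_O, hA_O, ?_⟩
  · have hL_eq : (fun t => L (x t) ls - L xs ls) =
        fun t => (f (x t) - f xs) + ⟪ls, A (x t) - b⟫ := by
      funext t
      rw [hL, hL, hA, sub_self, inner_zero_right]; ring
    rw [hL_eq]
    refine (isBigO_abs_left.1 hf_O).add (IsBigO.trans (IsBigO.of_bound ‖ls‖ ?_) hA_O)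
    exact Eventually.of_forall fun t => by
      rw [norm_norm]; exact norm_inner_le_norm _ _
  · refine IsBigO.of_bound (D * k₁) (main.mono fun t h => ?_)
    obtain ⟨-, -, -, -, h5, h6⟩ := h
    rwa [Real.norm_of_nonneg (add_nonneg (sq_nonneg _) (sq_nonneg _)), Real.norm_of_nonneg h5]
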